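/- arXiv:1401.3063 — 6 statements merged into one kernel-verified Lean document; each statement's English description precedes it below -/
import Mathlib

section
/- Let n ≥ 1 and let E ⊆ [0,1)^n. Then E has Lebesgue (outer) measure 0 if and only if there exists a martingale d on [0,1)^n that succeeds at every point x ∈ E. -/
open MeasureTheory Filter

/-- The dyadic cube `Q_r(u)` in `ℝ^n`. -/
def dyadicCube (n r : ℕ) (u : Fin n → ℤ) : Set (Fin n → ℝ) :=
  {x | ∀ i, (u i : ℝ) * 2 ^ (-(r : ℤ)) ≤ x i ∧ x i < ((u i : ℝ) + 1) * 2 ^ (-(r : ℤ))}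

/-- `u` indexes an `r`-dyadic cube inside `[0,1)^n`. -/
def validIndex (r : ℕ) {n : ℕ} (u : Fin n → ℤ) : Prop := ∀ i, 0 ≤ u i ∧ u i < 2 ^ r

/-- A martingale on `[0,1)^n`, presented as a nonnegative function on dyadic-cube
indices satisfying the fairness (averaging) condition on cubes inside `[0,1)^n`. -/
structure DyadicMartingale (n : ℕ) where
  toFun : ℕ → (Fin n → ℤ) → ℝ
  nonneg : ∀ r u, 0 ≤ toFun r u
  fair : ∀ r u, validIndex r u →
    toFun r u = (2 : ℝ) ^ (-(n : ℤ)) *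
      ∑ a : Fin n → Bool, toFun (r + 1) (fun i => 2 * u i + if a i then 1 else 0)

/-- The index of the unique `r`-dyadic cube containing `x ∈ [0,1)^n`. -/
noncomputable def dyadicIndex (n r : ℕ) (x : Fin n → ℝ) : Fin n → ℤ := fun i => ⌊x i * 2 ^ r⌋

/-- `d` succeeds at `x`: `limsup_r d^{(r)}(x) = ∞`. -/
def succeedsAt {n : ℕ} (d : DyadicMartingale n) (x : Fin n → ℝ) : Prop :=
  Filter.atTop.limsup (fun r => ((d.toFun r (dyadicIndex n r x) : ℝ) : EReal)) = ⊤

/-- The unit cube `[0,1)^n`. -/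
def unitCube (n : ℕ) : Set (Fin n → ℝ) := {x | ∀ i, 0 ≤ x i ∧ x i < 1}

/-- `E^# = [0,1)^n ∩ ⋃_{t ∈ ℤ^n} (E + t)`. -/
def sharp {n : ℕ} (E : Set (Fin n → ℝ)) : Set (Fin n → ℝ) :=
  unitCube n ∩ ⋃ t : Fin n → ℤ, (fun x => x + fun i => (t i : ℝ)) '' E

/-- A martingale is computable if its values can be uniformly computably
approximated to within `2^{-s}` by rationals. -/
def DyadicMartingale.IsComputable {n : ℕ} (d : DyadicMartingale n) : Prop :=
  ∃ dh : ℕ × ℕ × (Fin n → ℤ) → ℚ,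
    Computable dh ∧ (∀ p, 0 ≤ dh p) ∧
    ∀ s r u, validIndex r u →
      |(dh (s, r, u) : ℝ) - d.toFun r u| ≤ 2 ^ (-(s : ℤ))

/-- `E ⊆ ℝ^n` has computable measure 0. -/
def HasComputableMeasureZero {n : ℕ} (E : Set (Fin n → ℝ)) : Prop :=
  ∃ d : DyadicMartingale n, d.IsComputable ∧ ∀ x ∈ sharp E, succeedsAt d x

/-- `x ∈ ℝ^n` is computably random: no computable martingale succeeds at the
unique translate `x + t ∈ [0,1)^n` with `t ∈ ℤ^n`. -/
def ComputablyRandom {n : ℕ} (x : Fin n → ℝ) : Prop :=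
  ∀ d : DyadicMartingale n, d.IsComputable → ¬ succeedsAt d (fun i => Int.fract (x i))

theorem mem_dyadicCube_iff {n r : ℕ} {u : Fin n → ℤ} {x : Fin n → ℝ} :
    x ∈ dyadicCube n r u ↔ dyadicIndex n r x = u := by
  have h2 : (0 : ℝ) < 2 ^ r := by positivity
  simp only [dyadicCube, dyadicIndex, Set.mem_ofPred_eq, funext_iff, Int.floor_eq_iff,
    zpow_neg, zpow_natCast, ← div_eq_mul_inv, div_le_iff₀ h2, lt_div_iff₀ h2]

theorem mem_dyadicCube_dyadicIndex {n r : ℕ} (x : Fin n → ℝ) :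
    x ∈ dyadicCube n r (dyadicIndex n r x) :=
  mem_dyadicCube_iff.2 rfl

theorem dyadicCube_eq_pi (n r : ℕ) (u : Fin n → ℤ) :
    dyadicCube n r u = Set.pi Set.univ
      fun i => Set.Ico ((u i : ℝ) * 2 ^ (-(r : ℤ))) (((u i : ℝ) + 1) * 2 ^ (-(r : ℤ))) := by
  ext x
  simp [dyadicCube]

theorem measurableSet_dyadicCube (n r : ℕ) (u : Fin n → ℤ) :
    MeasurableSet (dyadicCube n r u) := by
  rw [dyadicCube_eq_pi]
  exact MeasurableSet.univ_pi fun _ => measurableSet_Ico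

theorem volume_dyadicCube (n r : ℕ) (u : Fin n → ℤ) :
    volume (dyadicCube n r u) = ENNReal.ofReal (((2 : ℝ) ^ (n * r))⁻¹) := by
  rw [dyadicCube_eq_pi, Real.volume_pi_Ico]
  have h : ∀ i : Fin n, ((u i : ℝ) + 1) * 2 ^ (-(r : ℤ)) - (u i : ℝ) * 2 ^ (-(r : ℤ))
      = ((2 : ℝ) ^ r)⁻¹ := by
    intro i
    rw [zpow_neg, zpow_natCast]
    ring
  simp only [h, Finset.prod_const, Finset.card_univ, Fintype.card_fin]
  rw [← ENNReal.ofReal_pow (by positivity), inv_pow, ← pow_mul, mul_comm]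

/-- The index of the child of the cube `u` selected by the binary vector `a`. -/
def childIndex {n : ℕ} (u : Fin n → ℤ) (a : Fin n → Bool) : Fin n → ℤ :=
  fun i => 2 * u i + if a i then 1 else 0

theorem childIndex_injective {n : ℕ} (u : Fin n → ℤ) : Function.Injective (childIndex u) := by
  intro a b h
  funext i
  have := congrFun h i
  simp only [childIndex] at this
  cases ha : a i <;> cases hb : b i <;> simp_all

theorem validIndex.childIndex {n r : ℕ} {u : Fin n → ℤ} (hu : validIndex r u)
    (a : Fin n → Bool) : validIndex (r + 1) (childIndex u a) := by
  intro i
  obtain ⟨h0, h1⟩ := hu i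
  have := pow_succ (2 : ℤ) r
  simp only [_root_.childIndex]
  split_ifs <;> constructor <;> linarith

theorem exists_dyadicIndex_succ {n : ℕ} (r : ℕ) (x : Fin n → ℝ) :
    ∃ a, dyadicIndex n (r + 1) x = childIndex (dyadicIndex n r x) a := by
  refine ⟨fun i => decide (dyadicIndex n (r + 1) x i ≠ 2 * dyadicIndex n r x i), ?_⟩
  funext i
  have hl := Int.floor_le (x i * 2 ^ r)
  have hu := Int.lt_floor_add_one (x i * 2 ^ r)
  have h1 : 2 * ⌊x i * 2 ^ r⌋ ≤ ⌊x i * 2 ^ (r + 1)⌋ := by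
    rw [Int.le_floor]
    push_cast
    rw [pow_succ]
    linarith
  have h2 : ⌊x i * 2 ^ (r + 1)⌋ < 2 * ⌊x i * 2 ^ r⌋ + 2 := by
    rw [Int.floor_lt]
    push_cast
    rw [pow_succ]
    linarith
  by_cases h : ⌊x i * 2 ^ (r + 1)⌋ = 2 * ⌊x i * 2 ^ r⌋
  · simp [childIndex, dyadicIndex, h]
  · simp only [childIndex, dyadicIndex, ne_eq, h, not_false_eq_true, decide_true, if_true]
    omega

theorem dyadicIndex_eq_of_succ {n r : ℕ} {u : Fin n → ℤ} {a : Fin n → Bool} {x : Fin n → ℝ}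
    (h : dyadicIndex n (r + 1) x = childIndex u a) : dyadicIndex n r x = u := by
  obtain ⟨b, hb⟩ := exists_dyadicIndex_succ r x
  rw [h] at hb
  funext i
  have := congrFun hb i
  simp only [childIndex] at this
  split_ifs at this <;> omega

theorem dyadicCube_eq_iUnion (n r : ℕ) (u : Fin n → ℤ) :
    dyadicCube n r u = ⋃ a, dyadicCube n (r + 1) (childIndex u a) := by
  ext x
  simp only [Set.mem_iUnion, mem_dyadicCube_iff]
  constructor
  · rintro rfl
    exact exists_dyadicIndex_succ r x
  · rintro ⟨a, ha⟩
    exact dyadicIndex_eq_of_succ ha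

theorem pairwise_disjoint_dyadicCube_childIndex (n r : ℕ) (u : Fin n → ℤ) :
    Pairwise (Function.onFun Disjoint fun a => dyadicCube n (r + 1) (childIndex u a)) := by
  intro a b hab
  refine Set.disjoint_left.2 fun x ha hb => hab (childIndex_injective u ?_)
  rw [← mem_dyadicCube_iff.1 ha, ← mem_dyadicCube_iff.1 hb]

theorem eventually_dyadicCube_subset {n : ℕ} {U : Set (Fin n → ℝ)} (hU : IsOpen U)
    {x : Fin n → ℝ} (hx : x ∈ U) :
    ∀ᶠ r in atTop, dyadicCube n r (dyadicIndex n r x) ⊆ U := by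
  obtain ⟨ε, hε, hball⟩ := Metric.isOpen_iff.1 hU x hx
  have hlim : Tendsto (fun r : ℕ => ((1 : ℝ) / 2) ^ r) atTop (nhds 0) :=
    tendsto_pow_atTop_nhds_zero_of_lt_one (by norm_num) (by norm_num)
  filter_upwards [hlim.eventually (gt_mem_nhds hε)] with r hr y hy
  refine hball ((dist_pi_lt_iff hε).2 fun i => lt_of_le_of_lt ?_ hr)
  obtain ⟨h1, h2⟩ := hy i
  obtain ⟨h3, h4⟩ := mem_dyadicCube_dyadicIndex (r := r) x i
  rw [add_mul, one_mul] at h2 h4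
  have : (2 : ℝ) ^ (-(r : ℤ)) = (1 / 2) ^ r := by
    rw [zpow_neg, zpow_natCast, one_div, inv_pow]
  rw [Real.dist_eq, abs_le, ← this]
  constructor <;> linarith

/-- The martingale of average densities of a finite measure. -/
noncomputable def DyadicMartingale.ofMeasure {n : ℕ} (μ : Measure (Fin n → ℝ))
    [IsFiniteMeasure μ] : DyadicMartingale n where
  toFun r u := 2 ^ (n * r) * μ.real (dyadicCube n r u)
  nonneg r u := by positivity
  fair r u _ := by
    rw [dyadicCube_eq_iUnion, measureReal_iUnion_fintype
      (pairwise_disjoint_dyadicCube_childIndex n r u) fun _ => measurableSet_dyadicCube _ _ _,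
      ← Finset.mul_sum, ← mul_assoc]
    congr 1
    rw [mul_add, pow_add, mul_one, zpow_neg, zpow_natCast]
    field_simp

theorem exists_martingale_succeeds_of_volume_eq_zero {n : ℕ} {E : Set (Fin n → ℝ)}
    (hE : volume E = 0) : ∃ d : DyadicMartingale n, ∀ x ∈ E, succeedsAt d x := by
  obtain ⟨ε, hε, hsum⟩ := ENNReal.exists_pos_sum_of_countable' one_ne_zero ℕ
  have hcover : ∀ k, ∃ U ⊇ E, IsOpen U ∧ volume U < ε k := fun k =>
    Set.exists_isOpen_lt_of_lt E _ (by rw [hE]; exact hε k)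
  choose U hEU hUo hUε using hcover
  let μ : Measure (Fin n → ℝ) := Measure.sum fun k => volume.restrict (U k)
  have hfin : IsFiniteMeasure μ := by
    refine ⟨?_⟩
    rw [Measure.sum_apply _ MeasurableSet.univ]
    simp only [Measure.restrict_apply_univ]
    exact ((ENNReal.tsum_le_tsum fun k => (hUε k).le).trans_lt hsum).trans ENNReal.one_lt_top
  refine ⟨DyadicMartingale.ofMeasure μ, fun x hx => ?_⟩
  refine Tendsto.limsup_eq (EReal.tendsto_nhds_top_iff_real.2 fun c => ?_)
  obtain ⟨K, hK⟩ := exists_nat_gt c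
  have hsub : ∀ᶠ r in atTop, ∀ k ∈ Finset.range K, dyadicCube n r (dyadicIndex n r x) ⊆ U k :=
    (Finset.eventually_all _).2 fun k _ => eventually_dyadicCube_subset (hUo k) (hEU k hx)
  filter_upwards [hsub] with r hr
  rw [EReal.coe_lt_coe_iff]
  refine hK.trans_le ?_
  set Q := dyadicCube n r (dyadicIndex n r x) with hQ
  have hle : (K : ENNReal) * volume Q ≤ μ Q := by
    rw [Measure.sum_apply _ (measurableSet_dyadicCube _ _ _)]
    refine le_trans ?_ (ENNReal.sum_le_tsum (Finset.range K))
    rw [Finset.sum_congr rfl fun k hk => Measure.restrict_eq_self volume (hr k hk)]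
    simp
  have hreal : (K : ℝ) * ((2 : ℝ) ^ (n * r))⁻¹ ≤ μ.real Q := by
    rw [hQ, volume_dyadicCube] at hle
    have := ENNReal.toReal_mono (measure_ne_top μ _) hle
    rwa [ENNReal.toReal_mul, ENNReal.toReal_natCast, ENNReal.toReal_ofReal (by positivity)] at this
  have h2 : (0 : ℝ) < 2 ^ (n * r) := by positivity
  rw [← div_eq_mul_inv, div_le_iff₀ h2, mul_comm] at hreal
  exact hreal

/-- A local, finite-horizon version of Ville's inequality. -/
theorem DyadicMartingale.mul_volume_le {n : ℕ} (d : DyadicMartingale n) (c : ℝ) (m : ℕ) :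
    ∀ (r : ℕ) (u : Fin n → ℤ), validIndex r u →
      ENNReal.ofReal c * volume {x ∈ dyadicCube n r u |
        ∃ s ≤ m, c ≤ d.toFun (r + s) (dyadicIndex n (r + s) x)} ≤
      ENNReal.ofReal (d.toFun r u * ((2 : ℝ) ^ (n * r))⁻¹) := by
  have large : ∀ (m r : ℕ) (u : Fin n → ℤ), c ≤ d.toFun r u →
      ENNReal.ofReal c * volume {x ∈ dyadicCube n r u |
        ∃ s ≤ m, c ≤ d.toFun (r + s) (dyadicIndex n (r + s) x)} ≤
      ENNReal.ofReal (d.toFun r u * ((2 : ℝ) ^ (n * r))⁻¹) := by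
    intro m r u h
    rw [ENNReal.ofReal_mul (d.nonneg r u), ← volume_dyadicCube n r u]
    gcongr
    exact Set.sep_subset _ _
  induction m with
  | zero =>
    intro r u _
    by_cases h : c ≤ d.toFun r u
    · exact large 0 r u h
    · have hempty : {x ∈ dyadicCube n r u |
          ∃ s ≤ 0, c ≤ d.toFun (r + s) (dyadicIndex n (r + s) x)} = ∅ := by
        refine Set.eq_empty_of_forall_notMem ?_
        rintro x ⟨hx, s, hs, hc⟩
        obtain rfl : s = 0 := by omega
        exact h (mem_dyadicCube_iff.1 hx ▸ hc)
      rw [hempty, measure_empty, mul_zero]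
      exact zero_le
  | succ m ih =>
    intro r u hu
    by_cases h : c ≤ d.toFun r u
    · exact large (m + 1) r u h
    have hsub : {x ∈ dyadicCube n r u |
        ∃ s ≤ m + 1, c ≤ d.toFun (r + s) (dyadicIndex n (r + s) x)} ⊆
        ⋃ a ∈ (Finset.univ : Finset (Fin n → Bool)),
          {x ∈ dyadicCube n (r + 1) (childIndex u a) |
            ∃ s ≤ m, c ≤ d.toFun (r + 1 + s) (dyadicIndex n (r + 1 + s) x)} := by
      rintro x ⟨hx, s, hs, hc⟩
      have hxu := mem_dyadicCube_iff.1 hx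
      rw [dyadicCube_eq_iUnion, Set.mem_iUnion] at hx
      obtain ⟨a, ha⟩ := hx
      simp only [Set.mem_iUnion]
      refine ⟨a, Finset.mem_univ a, ha, ?_⟩
      cases s with
      | zero => exact absurd (hxu ▸ hc) h
      | succ s =>
        refine ⟨s, by omega, ?_⟩
        rwa [show r + 1 + s = r + (s + 1) by omega]
    calc _ ≤ ENNReal.ofReal c * ∑ a : Fin n → Bool,
          volume {x ∈ dyadicCube n (r + 1) (childIndex u a) |
            ∃ s ≤ m, c ≤ d.toFun (r + 1 + s) (dyadicIndex n (r + 1 + s) x)} := by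
          gcongr
          exact (measure_mono hsub).trans (measure_biUnion_finset_le _ _)
      _ ≤ ∑ a : Fin n → Bool, ENNReal.ofReal
          (d.toFun (r + 1) (childIndex u a) * ((2 : ℝ) ^ (n * (r + 1)))⁻¹) := by
          rw [Finset.mul_sum]
          exact Finset.sum_le_sum fun a _ => ih (r + 1) _ (hu.childIndex a)
      _ = ENNReal.ofReal (d.toFun r u * ((2 : ℝ) ^ (n * r))⁻¹) := by
          rw [← ENNReal.ofReal_sum_of_nonneg fun a _ =>
            mul_nonneg (d.nonneg _ _) (by positivity), d.fair r u hu, ← Finset.sum_mul]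
          rw [mul_add, pow_add, mul_one, zpow_neg, zpow_natCast, mul_inv]
          unfold childIndex
          ring_nf

/-- Ville's inequality for dyadic martingales. -/
theorem DyadicMartingale.mul_volume_exists_le {n : ℕ} (d : DyadicMartingale n) (c : ℝ) :
    ENNReal.ofReal c * volume {x ∈ unitCube n | ∃ r, c ≤ d.toFun r (dyadicIndex n r x)} ≤
      ENNReal.ofReal (d.toFun 0 0) := by
  have heq : {x ∈ unitCube n | ∃ r, c ≤ d.toFun r (dyadicIndex n r x)} =
      ⋃ m : ℕ, {x ∈ dyadicCube n 0 0 |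
        ∃ s ≤ m, c ≤ d.toFun (0 + s) (dyadicIndex n (0 + s) x)} := by
    ext x
    simp only [unitCube, dyadicCube, Set.mem_ofPred_eq, Set.mem_iUnion, zero_add]
    simp only [Pi.zero_apply, Int.cast_zero, zero_add, CharP.cast_eq_zero, neg_zero,
      zpow_zero, mul_one]
    exact ⟨fun ⟨hx, r, hr⟩ => ⟨r, hx, r, le_rfl, hr⟩, fun ⟨_, hx, r, _, hr⟩ => ⟨hx, r, hr⟩⟩
  have hmono : Monotone fun m : ℕ => {x ∈ dyadicCube n 0 0 |
      ∃ s ≤ m, c ≤ d.toFun (0 + s) (dyadicIndex n (0 + s) x)} :=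
    fun _ _ hab _ ⟨hx, s, hs, hc⟩ => ⟨hx, s, hs.trans hab, hc⟩
  rw [heq, hmono.measure_iUnion, ENNReal.mul_iSup]
  refine iSup_le fun m => ?_
  simpa using d.mul_volume_le c m 0 0 (by intro i; simp)

theorem volume_eq_zero_of_martingale_succeeds {n : ℕ} {E : Set (Fin n → ℝ)}
    (hE : E ⊆ unitCube n) (d : DyadicMartingale n) (hd : ∀ x ∈ E, succeedsAt d x) :
    volume E = 0 := by
  have hbound : ∀ k : ℕ, (k : ENNReal) * volume E ≤ ENNReal.ofReal (d.toFun 0 0) := by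
    intro k
    refine le_trans ?_ (d.mul_volume_exists_le k)
    rw [ENNReal.ofReal_natCast]
    gcongr
    refine fun x hx => ⟨hE hx, ?_⟩
    by_contra! hlt
    have hle : atTop.limsup (fun r => ((d.toFun r (dyadicIndex n r x) : ℝ) : EReal)) ≤
        ((k : ℝ) : EReal) :=
      limsup_le_of_le (h := Eventually.of_forall fun r => EReal.coe_le_coe_iff.2 (hlt r).le)
    rw [hd x hx] at hle
    exact EReal.coe_ne_top _ (top_le_iff.1 hle)
  by_contra h0
  obtain ⟨k, hk⟩ := ENNReal.exists_nat_mul_gt h0 (ENNReal.ofReal_ne_top (r := d.toFun 0 0))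
  exact absurd (hbound k) (not_le.2 hk)

/-- For `n ≥ 1` and `E ⊆ [0,1)^n`: `E` has Lebesgue (outer) measure 0
iff some martingale on `[0,1)^n` succeeds at every point of `E`. -/
theorem measure_zero_iff_exists_martingale_succeeds
    (n : ℕ) (hn : 1 ≤ n) (E : Set (Fin n → ℝ)) (hE : E ⊆ unitCube n) :
    volume E = 0 ↔ ∃ d : DyadicMartingale n, ∀ x ∈ E, succeedsAt d x :=
  ⟨exists_martingale_succeeds_of_volume_eq_zero,
    fun ⟨d, hd⟩ => volume_eq_zero_of_martingale_succeeds hE d hd⟩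
end

section
/- The set B contains a line in every direction in ℝ²: for every θ ∈ ℝ there exists p ∈ ℝ² such that the line {p + s·(cos θ, sin θ) : s ∈ ℝ} is contained in B. -/
/-- The line in `ℝ²` with slope `m` and `y`-intercept `b`. -/
def lineMB (m b : ℝ) : Set (ℝ × ℝ) := {p | p.2 = m * p.1 + b}

/-- Falconer's line set operator: `L(F) = ⋃ {L_{m,b} | (m,b) ∈ F}`. -/
def lineSet (F : Set (ℝ × ℝ)) : Set (ℝ × ℝ) := ⋃ q ∈ F, lineMB q.1 q.2

/-- The contractions `S_i(x,y) = ((x,y) + (i, a_i))/4`, with `a = (2,0,3,1)`. -/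
noncomputable def Scontr (i : Fin 4) (p : ℝ × ℝ) : ℝ × ℝ :=
  ((p.1 + (i : ℝ)) / 4, (p.2 + (![2, 0, 3, 1] : Fin 4 → ℝ) i) / 4)

/-- `F(w)` for words `w` over `{0,1,2,3}`: `F(λ) = [0,1]²`, `F(iw) = S_i(F(w))`. -/
noncomputable def Fword : List (Fin 4) → Set (ℝ × ℝ)
  | [] => Set.Icc 0 1 ×ˢ Set.Icc 0 1
  | i :: w => Scontr i '' Fword w

/-- `F_k`, the union of `F(w)` over words of length `k`. -/
noncomputable def Fstage (k : ℕ) : Set (ℝ × ℝ) :=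
  ⋃ w ∈ {w : List (Fin 4) | w.length = k}, Fword w

/-- The fractal dust `F = ⋂_k F_k`. -/
noncomputable def Fdust : Set (ℝ × ℝ) := ⋂ k, Fstage k

/-- Rotation of `ℝ²` about the origin by `π/2`. -/
def rotHalfPi (p : ℝ × ℝ) : ℝ × ℝ := (-p.2, p.1)

/-- Reflection of `ℝ²` across the `y`-axis. -/
def refY (p : ℝ × ℝ) : ℝ × ℝ := (-p.1, p.2)

/-- The Besicovitch set `B`. -/
noncomputable def Bset : Set (ℝ × ℝ) :=
  lineSet Fdust ∪ rotHalfPi '' lineSet Fdust ∪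
    refY '' (lineSet Fdust ∪ rotHalfPi '' lineSet Fdust)


/-- The digit permutation `0 ↦ 2, 1 ↦ 0, 2 ↦ 3, 3 ↦ 1` underlying the vertical shifts `a_i`. -/
def interceptDigit : Fin 4 → Fin 4 := ![2, 0, 3, 1]

theorem Scontr_ofDigits (d : ℕ → Fin 4) :
    Scontr (d 0) (Real.ofDigits (fun i ↦ d (i + 1)),
        Real.ofDigits (fun i ↦ interceptDigit (d (i + 1)))) =
      (Real.ofDigits d, Real.ofDigits (interceptDigit ∘ d)) := by
  rw [Real.ofDigits_eq_sum_add_ofDigits d 1,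
    Real.ofDigits_eq_sum_add_ofDigits (interceptDigit ∘ d) 1]
  have h : ∀ j : Fin 4, (![2, 0, 3, 1] : Fin 4 → ℝ) j = (interceptDigit j : ℝ) := by
    intro j
    fin_cases j <;> simp [interceptDigit]
  ext
  · simp only [Scontr, Finset.range_one, Finset.sum_singleton, Real.ofDigitsTerm]
    push_cast
    ring
  · simp only [Scontr, h, Finset.range_one, Finset.sum_singleton, Real.ofDigitsTerm,
      Function.comp_def]
    push_cast
    ring

theorem ofDigits_mem_Fstage (k : ℕ) (d : ℕ → Fin 4) :
    (Real.ofDigits d, Real.ofDigits (interceptDigit ∘ d)) ∈ Fstage k := by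
  induction k generalizing d with
  | zero =>
    exact Set.mem_biUnion (x := []) rfl
      ⟨⟨Real.ofDigits_nonneg _, Real.ofDigits_le_one _⟩,
        ⟨Real.ofDigits_nonneg _, Real.ofDigits_le_one _⟩⟩
  | succ k ih =>
    obtain ⟨w, hw, hmem⟩ := Set.mem_iUnion₂.1 (ih fun i ↦ d (i + 1))
    refine Set.mem_biUnion (x := d 0 :: w) (congrArg (· + 1) hw) ?_
    exact ⟨_, hmem, Scontr_ofDigits d⟩

/-- The projection of the dust to the first coordinate covers `[0,1]`. -/
theorem exists_mem_Fdust {m : ℝ} (hm : m ∈ Set.Icc (0 : ℝ) 1) : ∃ b, (m, b) ∈ Fdust := by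
  obtain ⟨d, -, rfl⟩ := Real.ofDigits_SurjOn (b := 4) (by norm_num) hm
  exact ⟨_, Set.mem_iInter.2 fun k ↦ ofDigits_mem_Fstage k d⟩

/-- `L(F)` contains a line in the direction `(c, s)` when `s / c` lies in `[0,1]`. -/
theorem exists_line_subset_lineSet_Fdust {c s : ℝ} (hc : c ≠ 0)
    (h : s / c ∈ Set.Icc (0 : ℝ) 1) :
    ∃ p : ℝ × ℝ, ∀ t : ℝ, p + t • (c, s) ∈ lineSet Fdust := by
  obtain ⟨b, hb⟩ := exists_mem_Fdust h
  refine ⟨(0, b), fun t ↦ Set.mem_biUnion hb ?_⟩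
  simp only [lineMB, Set.mem_ofPred_eq, Prod.smul_mk, Prod.mk_add_mk, smul_eq_mul]
  field_simp
  ring

theorem div_mem_Icc_or_neg_div_mem_Icc {a b : ℝ} (h : |a| ≤ |b|) :
    a / b ∈ Set.Icc (0 : ℝ) 1 ∨ a / -b ∈ Set.Icc (0 : ℝ) 1 := by
  have hab : |a / b| ≤ 1 := by
    rw [abs_div]
    exact div_le_one_of_le₀ h (abs_nonneg b)
  rw [div_neg]
  rcases le_total 0 (a / b) with h0 | h0
  · exact .inl ⟨h0, (le_abs_self _).trans hab⟩
  · exact .inr ⟨neg_nonneg.2 h0, (neg_le_abs _).trans hab⟩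

/-- `B` contains a line in every direction: for every `θ` there is a
point `p` with `{p + s (cos θ, sin θ) : s ∈ ℝ} ⊆ B`. -/
theorem Bset_contains_line_every_direction (θ : ℝ) :
    ∃ p : ℝ × ℝ,
      {q : ℝ × ℝ | ∃ s : ℝ, q = p + s • (Real.cos θ, Real.sin θ)} ⊆ Bset := by
  obtain ⟨p, hp⟩ : ∃ p : ℝ × ℝ, ∀ t : ℝ, p + t • (Real.cos θ, Real.sin θ) ∈ Bset := by
    generalize hc : Real.cos θ = c
    generalize hs : Real.sin θ = s
    have hcs : s ^ 2 + c ^ 2 = 1 := by rw [← hc, ← hs, Real.sin_sq_add_cos_sq]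
    rcases le_total |s| |c| with h | h
    · have hc0 : c ≠ 0 := by
        rintro rfl
        simp_all
      rcases div_mem_Icc_or_neg_div_mem_Icc h with h | h
      · obtain ⟨p, hp⟩ := exists_line_subset_lineSet_Fdust hc0 h
        exact ⟨p, fun t ↦ .inl (.inl (hp t))⟩
      · obtain ⟨p, hp⟩ := exists_line_subset_lineSet_Fdust (neg_ne_zero.2 hc0) h
        refine ⟨refY p, fun t ↦ .inr ⟨_, .inl (hp t), ?_⟩⟩
        ext <;> simp [refY]
        ring
    · have hs0 : s ≠ 0 := by
        rintro rfl
        simp_all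
      rcases div_mem_Icc_or_neg_div_mem_Icc h with h | h
      · obtain ⟨p, hp⟩ := exists_line_subset_lineSet_Fdust hs0 h
        refine ⟨refY (rotHalfPi p), fun t ↦ .inr ⟨_, .inr ⟨_, hp t, rfl⟩, ?_⟩⟩
        ext <;> simp [refY, rotHalfPi]
      · obtain ⟨p, hp⟩ := exists_line_subset_lineSet_Fdust hs0
          (s := -c) (by rwa [neg_div, ← div_neg])
        refine ⟨rotHalfPi p, fun t ↦ .inl (.inr ⟨_, hp t, ?_⟩)⟩
        ext <;> simp [rotHalfPi]
        ring
  refine ⟨p, ?_⟩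
  rintro q ⟨t, rfl⟩
  exact hp t
end

section
/- The set B has two-dimensional Lebesgue measure 0. In particular, the line set L(F) has two-dimensional Lebesgue measure 0. -/
open MeasureTheory Metric Set Filter Topology
open scoped ENNReal Pointwise

/-- The base-`4` value of a word whose letters are read through `c`, most significant first. -/
noncomputable def wordValue (c : Fin 4 → ℝ) : List (Fin 4) → ℝ
  | [] => 0
  | i :: w => 4 ^ w.length * c i + wordValue c w

/-- The parameters `t` for which distinct words of equal length have
`ε`-separated values of `t * i + a i`. -/
def separatedParams (a : Fin 4 → ℝ) (ε : ℝ) : Set ℝ :=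
  {t | ∀ w w' : List (Fin 4), w.length = w'.length → w ≠ w' →
    ε ≤ |wordValue (fun i => t * (i : ℝ) + a i) w - wordValue (fun i => t * (i : ℝ) + a i) w'|}

lemma wordValue_linear (t : ℝ) (a b : Fin 4 → ℝ) (w : List (Fin 4)) :
    wordValue (fun i => t * a i + b i) w = t * wordValue a w + wordValue b w := by
  induction w with
  | nil => simp [wordValue]
  | cons i w ih => simp only [wordValue, ih]; ring

lemma wordValue_mem_Icc {c : Fin 4 → ℝ} (hc : ∀ i, c i ∈ Icc (0 : ℝ) 3) (w : List (Fin 4)) :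
    wordValue c w ∈ Icc (0 : ℝ) (4 ^ w.length - 1) := by
  induction w with
  | nil => simp [wordValue]
  | cons i w ih =>
    obtain ⟨h0, h1⟩ := hc i
    obtain ⟨h2, h3⟩ := ih
    have h4 : (0 : ℝ) < 4 ^ w.length := by positivity
    simp only [wordValue, List.length_cons, pow_succ, mem_Icc]
    constructor <;> nlinarith

lemma volume_image_affine (r c : ℝ) (s : Set ℝ) :
    volume ((fun z => (z + c) / r) '' s) = ENNReal.ofReal |r⁻¹| * volume s := by
  have h : (fun z => (z + c) / r) '' s = r⁻¹ • ((fun z => z + c) '' s) := by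
    rw [← image_smul, image_image]
    refine image_congr fun z _ => ?_
    simp only [smul_eq_mul]
    ring
  rw [h, Measure.addHaar_smul, image_add_right, measure_preimage_add_right]
  simp

lemma exists_word_of_subset_iUnion {c : Fin 4 → ℝ} {E : Set ℝ}
    (hE : E ⊆ ⋃ i, (fun z => (z + c i) / 4) '' E) (k : ℕ) {x : ℝ} (hx : x ∈ E) :
    ∃ w : List (Fin 4), w.length = k ∧ ∃ z ∈ E, (z + wordValue c w) / 4 ^ k = x := by
  induction k generalizing x with
  | zero => exact ⟨[], rfl, x, hx, by simp [wordValue]⟩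
  | succ k ih =>
    obtain ⟨i, z, hz, rfl⟩ := mem_iUnion.1 (hE hx)
    obtain ⟨w, rfl, z', hz', rfl⟩ := ih hz
    refine ⟨i :: w, rfl, z', hz', ?_⟩
    simp only [wordValue]
    field_simp
    ring

lemma volume_eq_zero_of_close_words {c : Fin 4 → ℝ} {E : Set ℝ} (hK : IsCompact E)
    (hE : E ⊆ ⋃ i, (fun z => (z + c i) / 4) '' E)
    (hc : ∀ ε > 0, ∃ w w' : List (Fin 4), w.length = w'.length ∧ w ≠ w' ∧
      |wordValue c w - wordValue c w'| < ε) : volume E = 0 := by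
  by_contra h0
  have hfin : volume E ≠ ∞ := hK.measure_lt_top.ne
  have hlt : volume E < 2 * volume E := by
    rw [two_mul]
    exact ENNReal.lt_add_right hfin h0
  have hev : ∀ᶠ r in 𝓝[>] (0 : ℝ), volume (cthickening r E) < 2 * volume E :=
    ((tendsto_measure_cthickening_of_isCompact hK).mono_left
      nhdsWithin_le_nhds).eventually_lt_const hlt
  obtain ⟨ε, hε, hεpos⟩ := (hev.and self_mem_nhdsWithin).exists
  obtain ⟨w, w', hlen, hne, hclose⟩ := hc ε hεpos
  set k := w.length with hk
  let piece : List.Vector (Fin 4) k → Set ℝ :=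
    fun v => (fun z => (z + wordValue c v.1) / 4 ^ k) '' E
  let v : List.Vector (Fin 4) k := ⟨w, rfl⟩
  let v' : List.Vector (Fin 4) k := ⟨w', hlen.symm⟩
  have hvv : v ≠ v' := fun h => hne (congrArg Subtype.val h)
  set r : ℝ≥0∞ := ENNReal.ofReal |((4 : ℝ) ^ k)⁻¹| with hr
  have hr0 : r ≠ 0 := by
    rw [hr, Ne, ENNReal.ofReal_eq_zero, not_le]
    positivity
  have hrt : r ≠ ∞ := ENNReal.ofReal_ne_top
  have hpiece : ∀ u, volume (piece u) = r * volume E := fun u => volume_image_affine _ _ _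
  have hcover : E ⊆ (piece v ∪ piece v') ∪ ⋃ u ∈ Finset.univ \ {v, v'}, piece u := by
    intro x hx
    obtain ⟨u, hmem⟩ : ∃ u, x ∈ piece u := by
      obtain ⟨u, hu, z, hz, hzx⟩ := exists_word_of_subset_iUnion hE k hx
      exact ⟨⟨u, hu⟩, z, hz, hzx⟩
    by_cases h1 : u = v
    · exact Or.inl (Or.inl (h1 ▸ hmem))
    by_cases h2 : u = v'
    · exact Or.inl (Or.inr (h2 ▸ hmem))
    exact Or.inr (mem_biUnion (by simp [h1, h2]) hmem)
  have hpair : volume (piece v ∪ piece v') < 2 * (r * volume E) := by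
    have hsub : piece v ∪ piece v' ⊆
        (fun z => (z + wordValue c w) / 4 ^ k) '' cthickening ε E := by
      rintro x (⟨z, hz, rfl⟩ | ⟨z, hz, rfl⟩)
      · exact ⟨z, self_subset_cthickening E hz, rfl⟩
      · refine ⟨z + wordValue c w' - wordValue c w, ?_, by simp [v']⟩
        refine mem_cthickening_of_dist_le _ z ε E hz ?_
        rw [Real.dist_eq, abs_sub_comm]
        refine le_trans (le_of_eq ?_) hclose.le
        congr 1
        ring
    refine (measure_mono hsub).trans_lt ?_
    rw [volume_image_affine, mul_left_comm]
    exact (ENNReal.mul_lt_mul_iff_right hr0 hrt).2 hε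
  have hrest : volume (⋃ u ∈ Finset.univ \ {v, v'}, piece u) ≤
      ∑ u ∈ Finset.univ \ {v, v'}, r * volume E :=
    (measure_biUnion_finset_le _ _).trans (Finset.sum_le_sum fun u _ => (hpiece u).le)
  have htotal : 2 * (r * volume E) + ∑ u ∈ Finset.univ \ {v, v'}, r * volume E = volume E := by
    have h2 : 2 * (r * volume E) = ∑ u ∈ ({v, v'} : Finset (List.Vector (Fin 4) k)),
        r * volume E := by
      rw [Finset.sum_pair hvv, two_mul]
    rw [h2, add_comm, Finset.sum_sdiff (Finset.subset_univ _), Finset.sum_const, Finset.card_univ,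
      card_vector, Fintype.card_fin, nsmul_eq_mul, ← mul_assoc]
    have h4 : ((4 ^ k : ℕ) : ℝ≥0∞) * r = 1 := by
      rw [hr, abs_of_pos (by positivity), ENNReal.ofReal_inv_of_pos (by positivity),
        ENNReal.ofReal_pow (by norm_num)]
      push_cast
      rw [ENNReal.ofReal_ofNat]
      exact ENNReal.mul_inv_cancel (by simp) (by simp)
    rw [h4, one_mul]
  have hsum : volume E ≤ volume (piece v ∪ piece v') +
      ∑ u ∈ Finset.univ \ {v, v'}, r * volume E :=
    (measure_mono hcover).trans ((measure_union_le _ _).trans (add_le_add_right hrest _))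
  refine lt_irrefl (volume E) (hsum.trans_lt ?_)
  conv_rhs => rw [← htotal]
  refine ENNReal.add_lt_add_right ?_ hpair
  exact ENNReal.sum_ne_top.2 fun u _ => ENNReal.mul_ne_top hrt hfin

lemma exists_add_eq_add_of_mapsTo {c : Fin 4 → ℝ} {E : Set ℝ} (hK : IsCompact E)
    (hne : E.Nonempty) (hE : ∀ i, ∀ z ∈ E, (z + c i) / 4 ∈ E) :
    ∃ i j, i ≠ j ∧ ∃ x ∈ E, ∃ y ∈ E, x + c i = y + c j := by
  by_contra! hcon
  let g : Fin 4 → ℝ → ℝ := fun i z => (z + c i) / 4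
  have hg : ∀ i, Continuous (g i) := fun i => by fun_prop
  have hdisj : ∀ i j, i ≠ j → Disjoint (g i '' E) (g j '' E) := by
    intro i j hij
    rw [Set.disjoint_left]
    rintro _ ⟨x, hx, rfl⟩ ⟨y, hy, hxy⟩
    refine hcon i j hij x hx y hy ?_
    simp only [g] at hxy
    linarith
  have hsep : ∀ᶠ δ in 𝓝[>] (0 : ℝ), ∀ i j, i ≠ j →
      Disjoint (thickening δ (g i '' E)) (thickening δ (g j '' E)) := by
    rw [eventually_all]
    intro i
    rw [eventually_all]
    intro j
    by_cases hij : i = j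
    · exact Eventually.of_forall fun _ h => (h hij).elim
    obtain ⟨δ, hδ, h⟩ := (hdisj i j hij).exists_thickenings (hK.image (hg i))
      (hK.image (hg j)).isClosed
    filter_upwards [Ioo_mem_nhdsGT hδ] with η hη _
    exact h.mono (thickening_mono hη.2.le _) (thickening_mono hη.2.le _)
  obtain ⟨δ, hδ, hδpos⟩ := (hsep.and self_mem_nhdsWithin).exists
  replace hδpos : 0 < δ := hδpos
  set U := thickening (4 * δ) E
  set V := thickening δ E
  have himage : ∀ i, g i '' U ⊆ thickening δ (g i '' E) := by
    rintro i _ ⟨z, hz, rfl⟩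
    obtain ⟨e, he, hze⟩ := mem_thickening_iff.1 hz
    refine mem_thickening_iff.2 ⟨g i e, mem_image_of_mem _ he, ?_⟩
    rw [Real.dist_eq] at hze ⊢
    have h : g i z - g i e = (z - e) / 4 := by simp only [g]; ring
    rw [h, abs_div, abs_of_pos (by norm_num : (0 : ℝ) < 4)]
    linarith
  have hsub : (⋃ i, g i '' U) ⊆ V := by
    refine iUnion_subset fun i => (himage i).trans (thickening_subset_of_subset δ ?_)
    rintro _ ⟨z, hz, rfl⟩
    exact hE i z hz
  have hvol : ∀ i, volume (g i '' U) = ENNReal.ofReal 4⁻¹ * volume U := by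
    intro i
    rw [volume_image_affine, abs_of_pos (by norm_num)]
  have hmeas : ∀ i, MeasurableSet (g i '' U) := by
    intro i
    have h : g i '' U = (fun z => 4 * z - c i) ⁻¹' U := by
      ext z
      constructor
      · rintro ⟨y, hy, rfl⟩
        simp only [g, mem_preimage]
        convert! hy using 1
        ring
      · intro hz
        exact ⟨4 * z - c i, hz, by simp only [g]; ring⟩
    rw [h]
    exact (isOpen_thickening.preimage (by fun_prop)).measurableSet
  have hUV : volume U ≤ volume V := by
    refine le_trans (le_of_eq ?_) (measure_mono hsub)
    rw [measure_iUnion (fun i j hij => (hδ i j hij).mono (himage i) (himage j)) hmeas,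
      tsum_fintype]
    simp only [hvol, Finset.sum_const, Finset.card_univ, Fintype.card_fin, nsmul_eq_mul]
    rw [← mul_assoc, ← ENNReal.ofReal_natCast, ← ENNReal.ofReal_mul (by positivity)]
    norm_num
  obtain ⟨M, hM, hmax⟩ := hK.exists_isGreatest hne
  have hdisjV : Disjoint V (Ioo (M + δ) (M + 4 * δ)) := by
    rw [Set.disjoint_left]
    intro z hz hz'
    obtain ⟨e, he, hze⟩ := mem_thickening_iff.1 hz
    rw [Real.dist_eq] at hze
    have := hmax he
    have := (abs_lt.1 hze).2
    linarith [hz'.1]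
  have hsubU : V ∪ Ioo (M + δ) (M + 4 * δ) ⊆ U := by
    refine union_subset (thickening_mono (by linarith) _) fun z hz => ?_
    refine mem_thickening_iff.2 ⟨M, hM, ?_⟩
    rw [Real.dist_eq, abs_lt]
    constructor <;> linarith [hz.1, hz.2]
  have hlt : volume V < volume V + volume (Ioo (M + δ) (M + 4 * δ)) := by
    refine ENNReal.lt_add_right hK.isBounded.thickening.measure_lt_top.ne ?_
    rw [Real.volume_Ioo, Ne, ENNReal.ofReal_eq_zero, not_le]
    linarith
  rw [← measure_union hdisjV measurableSet_Ioo] at hlt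
  exact lt_irrefl _ ((hlt.trans_le (measure_mono hsubU)).trans_le hUV)

/-- By the Lebesgue density theorem, separated parameters form a null set as soon as each of them
admits pairs of words with bounded difference of values and unbounded first coordinate. -/
lemma volume_separatedParams {a : Fin 4 → ℝ} {ε : ℝ} (hε : 0 < ε)
    (h : ∀ t ∈ separatedParams a ε, ∃ C, ∃ w w' : ℕ → List (Fin 4),
      (∀ k, (w k).length = (w' k).length ∧ w k ≠ w' k ∧
        |wordValue (fun i => t * (i : ℝ) + a i) (w k) -
          wordValue (fun i => t * (i : ℝ) + a i) (w' k)| ≤ C) ∧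
      Tendsto (fun k => |wordValue (fun i => (i : ℝ)) (w k) -
        wordValue (fun i => (i : ℝ)) (w' k)|) atTop atTop) :
    volume (separatedParams a ε) = 0 := by
  set S := separatedParams a ε with hS
  suffices hfalse : ∀ᵐ t ∂volume.restrict S, t ∉ S by
    have := ae_imp_of_ae_restrict hfalse
    refine measure_mono_null ?_ this
    intro t ht hcon
    exact hcon ht ht
  have hae : ∀ᵐ t ∂volume.restrict S, ∀ K : ℕ, _ :=
    ae_all_iff.2 fun K : ℕ =>
      IsUnifLocDoublingMeasure.ae_tendsto_measure_inter_div (volume : Measure ℝ) S K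
  filter_upwards [hae] with t ht htS
  obtain ⟨C, w, w', hw, hlim⟩ := h t htS
  set p : ℕ → ℝ := fun k => wordValue (fun i => (i : ℝ)) (w k) -
        wordValue (fun i => (i : ℝ)) (w' k) with hp
  set q : ℕ → ℝ := fun k => wordValue a (w k) - wordValue a (w' k) with hq
  have hval : ∀ s k, wordValue (fun i => s * (i : ℝ) + a i) (w k) -
      wordValue (fun i => s * (i : ℝ) + a i) (w' k) = s * p k + q k := by
    intro s k
    rw [wordValue_linear, wordValue_linear]
    simp only [hp, hq]
    ring
  simp only [hval] at hw
  obtain ⟨K, hK⟩ := exists_nat_ge (2 * C / ε)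
  have hpos : ∀ᶠ k in atTop, 0 < |p k| := hlim.eventually_gt_atTop 0
  have hδ : Tendsto (fun k => ε / 2 / |p k|) atTop (𝓝[>] 0) := by
    refine tendsto_nhdsWithin_iff.2 ⟨hlim.const_div_atTop _, ?_⟩
    filter_upwards [hpos] with k hk
    exact div_pos (by linarith) hk
  have hmem : ∀ᶠ k in atTop, t ∈ closedBall (-(q k) / p k) (K * (ε / 2 / |p k|)) := by
    filter_upwards [hpos] with k hk
    have hpk : p k ≠ 0 := abs_pos.1 hk
    have heq : t - -(q k) / p k = (t * p k + q k) / p k := by field_simp; ring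
    rw [mem_closedBall, Real.dist_eq, heq, abs_div, ← mul_div_assoc]
    refine div_le_div_of_nonneg_right ((hw k).2.2.trans ?_) hk.le
    rw [div_le_iff₀ hε] at hK
    linarith
  have htend := ht K (fun k => -(q k) / p k) (fun k => ε / 2 / |p k|) hδ hmem
  have hzero : ∀ᶠ k in atTop, volume (S ∩ closedBall (-(q k) / p k) (ε / 2 / |p k|)) /
      volume (closedBall (-(q k) / p k) (ε / 2 / |p k|)) = 0 := by
    filter_upwards [hpos] with k hk
    have hpk : p k ≠ 0 := abs_pos.1 hk
    have hempty : S ∩ closedBall (-(q k) / p k) (ε / 2 / |p k|) = ∅ := by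
      refine eq_empty_of_forall_notMem fun s hs => ?_
      have h1 := hs.1 (w k) (w' k) (hw k).1 (hw k).2.1
      have h2 := hs.2
      have heq : s - -(q k) / p k = (s * p k + q k) / p k := by field_simp; ring
      rw [mem_closedBall, Real.dist_eq, heq, abs_div, div_le_div_iff_of_pos_right hk] at h2
      rw [hval] at h1
      linarith
    rw [hempty, measure_empty, ENNReal.zero_div]
  exact zero_ne_one (tendsto_nhds_unique
    (tendsto_const_nhds.congr' (hzero.mono fun _ h => h.symm)) htend)

lemma le_max_abs_wordValue_sub {i j : Fin 4} (hij : i ≠ j) {w w' : List (Fin 4)}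
    (h : w.length = w'.length) :
    4 ^ w.length ≤ max
      |wordValue (fun i => (i : ℝ)) (i :: w) - wordValue (fun i => (i : ℝ)) (j :: w')|
      |wordValue ![2, 0, 3, 1] (i :: w) - wordValue ![2, 0, 3, 1] (j :: w')| := by
  have hc : ∀ i : Fin 4, (fun i : Fin 4 => (i : ℝ)) i ∈ Icc (0 : ℝ) 3 := by
    intro i
    fin_cases i <;> norm_num
  have ha : ∀ i : Fin 4, (![2, 0, 3, 1] : Fin 4 → ℝ) i ∈ Icc (0 : ℝ) 3 := by
    intro i
    fin_cases i <;> norm_num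
  obtain ⟨h1, h2⟩ := wordValue_mem_Icc hc w
  obtain ⟨h3, h4⟩ := wordValue_mem_Icc hc w'
  obtain ⟨h5, h6⟩ := wordValue_mem_Icc ha w
  obtain ⟨h7, h8⟩ := wordValue_mem_Icc ha w'
  rw [← h] at h4 h8
  have hpow : (0 : ℝ) < 4 ^ w.length := by positivity
  simp only [wordValue, ← h, le_max_iff, le_abs]
  fin_cases i <;> fin_cases j <;> simp at hij ⊢ <;>
  first
  | exact Or.inl (Or.inl (by linarith))
  | exact Or.inl (Or.inr (by linarith))
  | exact Or.inr (Or.inl (by linarith))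
  | exact Or.inr (Or.inr (by linarith))

lemma Fstage_zero : Fstage 0 = Icc 0 1 ×ˢ Icc 0 1 := by
  simp [Fstage, Fword]

lemma Fstage_succ (k : ℕ) : Fstage (k + 1) = ⋃ i, Scontr i '' Fstage k := by
  ext x
  simp only [Fstage, mem_iUnion, mem_ofPred_eq, mem_image, exists_prop]
  constructor
  · rintro ⟨_ | ⟨i, w⟩, hw, hx⟩
    · simp at hw
    · obtain ⟨y, hy, rfl⟩ := hx
      exact ⟨i, y, ⟨w, by simpa using hw, hy⟩, rfl⟩
  · rintro ⟨i, y, ⟨w, hw, hy⟩, rfl⟩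
    exact ⟨i :: w, by simp [hw], y, hy, rfl⟩

lemma continuous_Scontr (i : Fin 4) : Continuous (Scontr i) := by
  unfold Scontr
  fun_prop

lemma injective_Scontr (i : Fin 4) : Function.Injective (Scontr i) := by
  rintro ⟨x, y⟩ ⟨x', y'⟩ h
  simp only [Scontr, Prod.mk.injEq] at h
  ext <;> simp only <;> linarith [h.1, h.2]

lemma isCompact_Fstage (k : ℕ) : IsCompact (Fstage k) := by
  induction k with
  | zero =>
    rw [Fstage_zero]
    exact isCompact_Icc.prod isCompact_Icc
  | succ k ih =>
    rw [Fstage_succ]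
    exact isCompact_iUnion fun i => ih.image (continuous_Scontr i)

lemma antitone_Fstage : Antitone Fstage := by
  refine antitone_nat_of_succ_le fun k => ?_
  induction k with
  | zero =>
    rw [Fstage_succ, Fstage_zero]
    refine iUnion_subset fun i => ?_
    rintro _ ⟨⟨x, y⟩, ⟨⟨hx0, hx1⟩, hy0, hy1⟩, rfl⟩
    simp only at hx0 hx1 hy0 hy1
    fin_cases i <;> simp [Scontr] <;> refine ⟨⟨?_, ?_⟩, ?_, ?_⟩ <;> linarith
  | succ k ih =>
    refine (Fstage_succ (k + 1)).le.trans (le_trans ?_ (Fstage_succ k).ge)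
    exact iUnion_mono fun i => image_mono ih

lemma isCompact_Fdust : IsCompact Fdust :=
  (isCompact_Fstage 0).of_isClosed_subset
    (isClosed_iInter fun k => (isCompact_Fstage k).isClosed) (iInter_subset _ 0)

lemma Scontr_mem_Fdust (i : Fin 4) {p : ℝ × ℝ} (hp : p ∈ Fdust) : Scontr i p ∈ Fdust := by
  refine mem_iInter.2 fun k => antitone_Fstage (Nat.le_succ k) ?_
  rw [Fstage_succ]
  exact mem_iUnion.2 ⟨i, p, mem_iInter.1 hp k, rfl⟩

lemma Fdust_subset_iUnion : Fdust ⊆ ⋃ i, Scontr i '' Fdust := by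
  intro x hx
  by_contra hcon
  have hk : ∀ i, ∃ k, x ∉ Scontr i '' Fstage k := by
    intro i
    by_contra! hall
    obtain ⟨y, -, rfl⟩ := hall 0
    refine hcon (mem_iUnion.2 ⟨i, y, mem_iInter.2 fun k => ?_, rfl⟩)
    exact (injective_Scontr i).mem_set_image.1 (hall k)
  choose k hk using hk
  have hx' := mem_iInter.1 hx (Finset.univ.sup k + 1)
  rw [Fstage_succ] at hx'
  obtain ⟨i, hi⟩ := mem_iUnion.1 hx'
  exact hk i (image_mono (antitone_Fstage (Finset.le_sup (Finset.mem_univ i))) hi)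

/-- The slice of the line set of the dust above `t`. -/
noncomputable def dustSlice (t : ℝ) : Set ℝ := (fun q : ℝ × ℝ => t * q.1 + q.2) '' Fdust

lemma isCompact_dustSlice (t : ℝ) : IsCompact (dustSlice t) :=
  isCompact_Fdust.image (by fun_prop)

lemma proj_Scontr (t : ℝ) (i : Fin 4) (q : ℝ × ℝ) :
    t * (Scontr i q).1 + (Scontr i q).2 =
      (t * q.1 + q.2 + (t * (i : ℝ) + (![2, 0, 3, 1] : Fin 4 → ℝ) i)) / 4 := by
  simp only [Scontr]
  ring

lemma dustSlice_subset_iUnion (t : ℝ) : dustSlice t ⊆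
    ⋃ i : Fin 4, (fun z => (z + (t * (i : ℝ) + (![2, 0, 3, 1] : Fin 4 → ℝ) i)) / 4) ''
      dustSlice t := by
  rintro _ ⟨q, hq, rfl⟩
  obtain ⟨i, q', hq', rfl⟩ := mem_iUnion.1 (Fdust_subset_iUnion hq)
  exact mem_iUnion.2 ⟨i, _, mem_image_of_mem _ hq', (proj_Scontr t i q').symm⟩

lemma mapsTo_dustSlice (t : ℝ) (i : Fin 4) {z : ℝ} (hz : z ∈ dustSlice t) :
    (z + (t * (i : ℝ) + (![2, 0, 3, 1] : Fin 4 → ℝ) i)) / 4 ∈ dustSlice t := by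
  obtain ⟨q, hq, rfl⟩ := hz
  exact ⟨Scontr i q, Scontr_mem_Fdust i hq, proj_Scontr t i q⟩

lemma Fword_proj (t : ℝ) (w : List (Fin 4)) {p : ℝ × ℝ} (hp : p ∈ Fword w) :
    ∃ z ∈ Icc (0 : ℝ) 1 ×ˢ Icc (0 : ℝ) 1, 4 ^ w.length * (t * p.1 + p.2) = t * z.1 + z.2 +
      wordValue (fun i => t * (i : ℝ) + (![2, 0, 3, 1] : Fin 4 → ℝ) i) w := by
  induction w generalizing p with
  | nil => exact ⟨p, hp, by simp [wordValue]⟩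
  | cons i w ih =>
    obtain ⟨q, hq, rfl⟩ := hp
    obtain ⟨z, hz, h⟩ := ih hq
    refine ⟨z, hz, ?_⟩
    rw [proj_Scontr, wordValue, List.length_cons, pow_succ]
    linear_combination h

lemma exists_words_close {t : ℝ} (hne : (dustSlice t).Nonempty) (k : ℕ) :
    ∃ i j : Fin 4, i ≠ j ∧ ∃ w w' : List (Fin 4), w.length = k ∧ w'.length = k ∧
      |wordValue (fun i => t * (i : ℝ) + (![2, 0, 3, 1] : Fin 4 → ℝ) i) (i :: w) -
        wordValue (fun i => t * (i : ℝ) + (![2, 0, 3, 1] : Fin 4 → ℝ) i) (j :: w')| ≤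
          |t| + 1 := by
  obtain ⟨i, j, hij, _, ⟨p, hp, rfl⟩, _, ⟨q, hq, rfl⟩, h⟩ :=
    exists_add_eq_add_of_mapsTo (isCompact_dustSlice t) hne
      (fun i _ hz => mapsTo_dustSlice t i hz)
  have hpk := mem_iInter.1 hp k
  have hqk := mem_iInter.1 hq k
  simp only [Fstage, mem_iUnion, mem_ofPred_eq, exists_prop] at hpk hqk
  obtain ⟨w, hw, hpw⟩ := hpk
  obtain ⟨w', hw', hqw⟩ := hqk
  obtain ⟨y, ⟨⟨hy1, hy2⟩, hy3, hy4⟩, hy⟩ := Fword_proj t w hpw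
  obtain ⟨z, ⟨⟨hz1, hz2⟩, hz3, hz4⟩, hz⟩ := Fword_proj t w' hqw
  refine ⟨i, j, hij, w, w', hw, hw', ?_⟩
  rw [hw] at hy
  rw [hw'] at hz
  simp only at h
  rw [wordValue, wordValue, hw, hw']
  have heq : 4 ^ k * (t * (i : ℝ) + (![2, 0, 3, 1] : Fin 4 → ℝ) i) +
      wordValue (fun i => t * (i : ℝ) + (![2, 0, 3, 1] : Fin 4 → ℝ) i) w -
      (4 ^ k * (t * (j : ℝ) + (![2, 0, 3, 1] : Fin 4 → ℝ) j) +
      wordValue (fun i => t * (i : ℝ) + (![2, 0, 3, 1] : Fin 4 → ℝ) i) w') =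
      t * (z.1 - y.1) + (z.2 - y.2) := by
    linear_combination 4 ^ k * h - hy + hz
  rw [heq]
  refine (abs_add_le _ _).trans (add_le_add ?_ ?_)
  · rw [abs_mul]
    refine mul_le_of_le_one_right (abs_nonneg t) (abs_le.2 ⟨?_, ?_⟩) <;> linarith
  · refine abs_le.2 ⟨?_, ?_⟩ <;> linarith

lemma nonempty_Fdust : Fdust.Nonempty := by
  refine ⟨(1 / 3, 0), mem_iInter.2 fun k => ?_⟩
  induction k with
  | zero =>
    rw [Fstage_zero]
    norm_num
  | succ k ih =>
    rw [Fstage_succ]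
    exact mem_iUnion.2 ⟨1, _, ih, by norm_num [Scontr]⟩

lemma volume_separatedParams_dust {ε : ℝ} (hε : 0 < ε) :
    volume (separatedParams ![2, 0, 3, 1] ε) = 0 := by
  refine volume_separatedParams hε fun t _ => ?_
  choose i j hij w w' hw hw' hclose using
    exists_words_close (nonempty_Fdust.image _ : (dustSlice t).Nonempty)
  refine ⟨|t| + 1, fun k => i k :: w k, fun k => j k :: w' k, fun k => ⟨by simp [hw, hw'],
    fun h => hij k (List.cons.inj h).1, hclose k⟩, ?_⟩
  have hpow : Tendsto (fun k : ℕ => ((4 : ℝ) ^ k - (|t| + 1)) / (|t| + 1)) atTop atTop :=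
    (tendsto_atTop_add_const_right _ _
      (tendsto_pow_atTop_atTop_of_one_lt (by norm_num))).atTop_div_const (by positivity)
  refine tendsto_atTop_mono (fun k => ?_) hpow
  have hmax := le_max_abs_wordValue_sub (hij k) ((hw k).trans (hw' k).symm)
  have hcl := hclose k
  rw [wordValue_linear, wordValue_linear] at hcl
  rw [hw] at hmax
  set P := wordValue (fun i => (i : ℝ)) (i k :: w k) - wordValue (fun i => (i : ℝ)) (j k :: w' k)
    with hP
  set Q := wordValue ![2, 0, 3, 1] (i k :: w k) - wordValue ![2, 0, 3, 1] (j k :: w' k) with hQ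
  have hQle : |Q| ≤ (|t| + 1) + |t| * |P| := by
    rw [← abs_mul]
    refine le_trans ?_ (add_le_add_left hcl _)
    refine le_trans (le_of_eq ?_) (abs_sub _ _)
    congr 1
    simp only [hP, hQ]
    ring
  rw [div_le_iff₀ (by positivity)]
  have h1 := abs_nonneg t
  have h2 := abs_nonneg P
  rcases le_max_iff.1 hmax with h | h <;> nlinarith

lemma ae_volume_dustSlice : ∀ᵐ t : ℝ, volume (dustSlice t) = 0 := by
  have hae : ∀ᵐ t : ℝ, ∀ n : ℕ, t ∉ separatedParams ![2, 0, 3, 1] (1 / ((n : ℝ) + 1)) :=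
    ae_all_iff.2 fun n => measure_eq_zero_iff_ae_notMem.1
      (volume_separatedParams_dust (by positivity))
  filter_upwards [hae] with t ht
  refine volume_eq_zero_of_close_words (isCompact_dustSlice t) (dustSlice_subset_iUnion t)
    fun ε hε => ?_
  obtain ⟨n, hn⟩ := exists_nat_one_div_lt hε
  have htn := ht n
  simp only [separatedParams, mem_ofPred_eq, not_forall, not_le] at htn
  obtain ⟨w, w', hlen, hne, hlt⟩ := htn
  exact ⟨w, w', hlen, hne, hlt.trans hn⟩

lemma measurableSet_lineSet_Fdust : MeasurableSet (lineSet Fdust) := by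
  have h : lineSet Fdust = ⋃ n : ℕ, (fun r : (ℝ × ℝ) × ℝ => (r.2, r.1.1 * r.2 + r.1.2)) ''
      (Fdust ×ˢ closedBall (0 : ℝ) n) := by
    ext ⟨x, y⟩
    simp only [lineSet, lineMB, mem_iUnion, mem_ofPred_eq, exists_prop, mem_image]
    constructor
    · rintro ⟨q, hq, rfl⟩
      obtain ⟨n, hn⟩ := exists_nat_ge |x|
      exact ⟨n, (q, x), ⟨hq, by simpa using hn⟩, rfl⟩
    · rintro ⟨n, ⟨q, z⟩, ⟨hq, -⟩, hqz⟩
      simp only [Prod.mk.injEq] at hqz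
      obtain ⟨rfl, rfl⟩ := hqz
      exact ⟨q, hq, rfl⟩
  rw [h]
  exact MeasurableSet.iUnion fun n =>
    ((isCompact_Fdust.prod (isCompact_closedBall _ _)).image (by fun_prop)).measurableSet

lemma volume_lineSet_Fdust : volume (lineSet Fdust) = 0 := by
  rw [Measure.volume_eq_prod, Measure.measure_prod_null measurableSet_lineSet_Fdust]
  filter_upwards [ae_volume_dustSlice] with t ht
  refine measure_mono_null ?_ ht
  intro y hy
  simp only [lineSet, lineMB, mem_preimage, mem_iUnion, mem_ofPred_eq, exists_prop] at hy
  obtain ⟨q, hq, rfl⟩ := hy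
  exact ⟨q, hq, by ring⟩

lemma volume_rotHalfPi_image {s : Set (ℝ × ℝ)} (hs : volume s = 0) :
    volume (rotHalfPi '' s) = 0 := by
  let f : ℝ × ℝ →ₗ[ℝ] ℝ × ℝ := (-LinearMap.snd ℝ ℝ ℝ).prod (LinearMap.fst ℝ ℝ ℝ)
  have h := Measure.addHaar_image_linearMap volume f s
  rw [hs, mul_zero] at h
  exact h

lemma volume_refY_image {s : Set (ℝ × ℝ)} (hs : volume s = 0) : volume (refY '' s) = 0 := by
  let f : ℝ × ℝ →ₗ[ℝ] ℝ × ℝ := (-LinearMap.fst ℝ ℝ ℝ).prod (LinearMap.snd ℝ ℝ ℝ)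
  have h := Measure.addHaar_image_linearMap volume f s
  rw [hs, mul_zero] at h
  exact h

/-- `B` has two-dimensional Lebesgue measure 0; in particular
`L(F)` has two-dimensional Lebesgue measure 0. -/
theorem Bset_volume_zero :
    MeasureTheory.volume Bset = 0 ∧ MeasureTheory.volume (lineSet Fdust) = 0 := by
  have h := volume_lineSet_Fdust
  have h' := measure_union_null h (volume_rotHalfPi_image h)
  exact ⟨measure_union_null h' (volume_refY_image h'), h⟩
end

section
/- Let I and J be closed intervals of finite length in ℝ, let R = I × J, and let R′ = (I × J°) ∪ (I° × J) be R with its four corners removed, where I° and J° denote the interiors of I and J. Then L(R′) ⊆ L(R)° ∪ Y, where L(R)° is the interior of L(R) in ℝ² and Y = {(0,y) : y ∈ ℝ} is the y-axis of ℝ². -/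
/-- For closed intervals `I = [a,b]`, `J = [c,d]`, with
`R = I × J` and `R' = (I × J°) ∪ (I° × J)` (the rectangle with its four corners
removed): `L(R') ⊆ L(R)° ∪ Y`, where `Y` is the `y`-axis. -/
theorem lineSet_corners_removed_subset (a b c d : ℝ) :
    lineSet ((Set.Icc a b ×ˢ interior (Set.Icc c d)) ∪
        (interior (Set.Icc a b) ×ˢ Set.Icc c d)) ⊆
      interior (lineSet (Set.Icc a b ×ˢ Set.Icc c d)) ∪ {p : ℝ × ℝ | p.1 = 0} := by
  intro p hp
  simp only [lineSet, lineMB, Set.mem_iUnion, Set.mem_ofPred_eq, exists_prop, interior_Icc] at hp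
  obtain ⟨⟨m, k⟩, hmk, hpk⟩ := hp
  by_cases hx : p.1 = 0
  · exact Or.inr hx
  refine Or.inl (mem_interior_iff_mem_nhds.2 ?_)
  rcases hmk with ⟨hm, hk⟩ | ⟨hm, hk⟩
  · have hcont : ContinuousAt (fun q : ℝ × ℝ => q.2 - m * q.1) p := by fun_prop
    have hval : p.2 - m * p.1 = k := by rw [hpk]; ring
    filter_upwards [hcont.preimage_mem_nhds (Ioo_mem_nhds (hval ▸ hk.1) (hval ▸ hk.2))] with q hq
    refine Set.mem_biUnion (x := (m, q.2 - m * q.1)) ⟨hm, Set.Ioo_subset_Icc_self hq⟩ ?_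
    simp [lineMB]
  · have hcont : ContinuousAt (fun q : ℝ × ℝ => (q.2 - k) / q.1) p := by fun_prop (disch := exact hx)
    have hval : (p.2 - k) / p.1 = m := by rw [hpk]; field_simp; ring
    filter_upwards [hcont.preimage_mem_nhds (Ioo_mem_nhds (hval ▸ hm.1) (hval ▸ hm.2)),
      continuousAt_fst.eventually_ne hx] with q hq hqx
    refine Set.mem_biUnion (x := ((q.2 - k) / q.1, k)) ⟨Set.Ioo_subset_Icc_self hq, hk⟩ ?_
    simp [lineMB, div_mul_cancel₀ _ hqx]
end

section
/- For every k ∈ ℕ, L(F_{k+1}) ⊆ L(F_k)° ∪ Y, where L(F_k)° is the interior of L(F_k) in ℝ² and Y = {(0,y) : y ∈ ℝ} is the y-axis of ℝ². -/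
theorem mem_lineSet {F : Set (ℝ × ℝ)} {p : ℝ × ℝ} :
    p ∈ lineSet F ↔ ∃ q ∈ F, p.2 = q.1 * p.1 + q.2 := by
  simp [lineSet, lineMB]

/-- A point lying strictly above one line and strictly below another line of a convex family is
interior to the line set of the family. -/
theorem Convex.mem_interior_lineSet {K : Set (ℝ × ℝ)} (hK : Convex ℝ K) {q₁ q₂ p : ℝ × ℝ}
    (hq₁ : q₁ ∈ K) (hq₂ : q₂ ∈ K) (h₁ : q₁.1 * p.1 + q₁.2 < p.2) (h₂ : p.2 < q₂.1 * p.1 + q₂.2) :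
    p ∈ interior (lineSet K) := by
  refine mem_interior.2
    ⟨{z | q₁.1 * z.1 + q₁.2 < z.2} ∩ {z | z.2 < q₂.1 * z.1 + q₂.2}, ?_, ?_, h₁, h₂⟩
  · rintro z ⟨hz₁, hz₂⟩
    simp only [Set.mem_ofPred_eq] at hz₁ hz₂
    set D := q₂.1 * z.1 + q₂.2 - (q₁.1 * z.1 + q₁.2) with hD
    have hD₀ : 0 < D := by linarith
    set t := (z.2 - (q₁.1 * z.1 + q₁.2)) / D with ht
    have ht₀ : 0 ≤ t := div_nonneg (by linarith) hD₀.le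
    have ht₁ : t ≤ 1 := (div_le_one hD₀).2 (by linarith)
    have htD : t * D = z.2 - (q₁.1 * z.1 + q₁.2) := div_mul_cancel₀ _ hD₀.ne'
    refine mem_lineSet.2 ⟨(1 - t) • q₁ + t • q₂, hK hq₁ hq₂ (by linarith) ht₀ (by ring), ?_⟩
    simp only [Prod.fst_add, Prod.snd_add, Prod.smul_fst, Prod.smul_snd, smul_eq_mul]
    rw [hD] at htD
    linear_combination -htD
  · exact (isOpen_lt (by fun_prop) (by fun_prop)).inter (isOpen_lt (by fun_prop) (by fun_prop))

/-- Prepending a word acts on the sets `Fword` as a fixed positive homothety. -/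
theorem exists_Fword_append_eq_image (w : List (Fin 4)) :
    ∃ r : ℝ, 0 < r ∧ ∃ c : ℝ × ℝ, ∀ v, Fword (w ++ v) = (fun p => c + r • p) '' Fword v := by
  induction w with
  | nil => exact ⟨1, one_pos, 0, fun v => by simp⟩
  | cons i w ih =>
    obtain ⟨r, hr, c, h⟩ := ih
    refine ⟨r / 4, by positivity, Scontr i c, fun v => ?_⟩
    rw [List.cons_append, Fword, h, Set.image_image]
    congr 1
    ext p <;> simp [Scontr] <;> ring

theorem lineSet_mono {F G : Set (ℝ × ℝ)} (h : F ⊆ G) : lineSet F ⊆ lineSet G :=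
  Set.biUnion_subset_biUnion_left h

/-- Off the `y`-axis, a linear functional `(m, b) ↦ m * x + b` on the unit square takes its extreme
values only at corners, and the first-stage squares avoid these. -/
theorem exists_unitSquare_lt_lt {i : Fin 4} {q : ℝ × ℝ} (hq : q ∈ Fword [i]) {x : ℝ} (hx : x ≠ 0) :
    ∃ q₁ ∈ Fword [], ∃ q₂ ∈ Fword [],
      q₁.1 * x + q₁.2 < q.1 * x + q.2 ∧ q.1 * x + q.2 < q₂.1 * x + q₂.2 := by
  obtain ⟨⟨u, v⟩, ⟨⟨hu₀, hu₁⟩, hv₀, hv₁⟩, rfl⟩ := hq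
  simp only at hu₀ hu₁ hv₀ hv₁
  rcases hx.lt_or_gt with hx | hx
  · refine ⟨(1, 0), by simp [Fword], (0, 1), by simp [Fword], ?_⟩
    fin_cases i <;> simp [Scontr] <;> constructor <;> nlinarith
  · refine ⟨(0, 0), by simp [Fword], (1, 1), by simp [Fword], ?_⟩
    fin_cases i <;> simp [Scontr] <;> constructor <;> nlinarith

/-- For every `k`, `L(F_{k+1}) ⊆ L(F_k)° ∪ Y`, where `Y` is the
`y`-axis. -/
theorem lineSet_Fstage_succ_subset (k : ℕ) :
    lineSet (Fstage (k + 1)) ⊆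
      interior (lineSet (Fstage k)) ∪ {p : ℝ × ℝ | p.1 = 0} := by
  intro p hp
  rw [Set.mem_union, or_iff_not_imp_right]
  intro hx
  obtain ⟨q, hq, hpq⟩ := mem_lineSet.1 hp
  obtain ⟨w', hw', hq⟩ := Set.mem_iUnion₂.1 hq
  obtain ⟨w, i, rfl⟩ := List.eq_nil_or_concat' w' |>.resolve_left (by rintro rfl; simp at hw')
  have hw : w.length = k := by simpa using hw'
  obtain ⟨r, hr, c, h⟩ := exists_Fword_append_eq_image w
  rw [h] at hq
  obtain ⟨s, hs, rfl⟩ := hq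
  obtain ⟨q₁, hq₁, q₂, hq₂, h₁, h₂⟩ := exists_unitSquare_lt_lt hs hx
  have hFw := h []
  rw [List.append_nil] at hFw
  have hconv : Convex ℝ (Fword w) := by
    rw [hFw]
    exact ((convex_Icc 0 1).prod (convex_Icc 0 1)).affinity c r
  refine interior_mono (lineSet_mono (Set.subset_biUnion_of_mem (u := Fword) hw))
    (hconv.mem_interior_lineSet (q₁ := c + r • q₁) (q₂ := c + r • q₂)
      (hFw ▸ Set.mem_image_of_mem _ hq₁) (hFw ▸ Set.mem_image_of_mem _ hq₂) ?_ ?_)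
  all_goals
    rw [hpq]
    simp only [Prod.fst_add, Prod.snd_add, Prod.smul_fst, Prod.smul_snd, smul_eq_mul]
    have := mul_lt_mul_of_pos_left h₁ hr
    have := mul_lt_mul_of_pos_left h₂ hr
    linarith
end

section
/- The set B has computable measure 0: there exists a computable martingale d on [0,1)² that succeeds at every point x ∈ B^#, where B^# = [0,1)² ∩ ⋃_{t∈ℤ²}(B+t). -/
open MeasureTheory Filter

/-- `B` viewed as a subset of `ℝ² = Fin 2 → ℝ`. -/
noncomputable def BsetFin : Set (Fin 2 → ℝ) := {x | (x 0, x 1) ∈ Bset}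

/-- The digit substitution `0123 ↦ 2031` applied to the `k` lowest base-`4` digits of `n`. -/
def digitSubst (k n : ℕ) : ℕ := ∑ i ∈ Finset.range k, 4 ^ i * ((3 * (n / 4 ^ i % 4) + 2) % 5)

theorem digitSubst_lt (k n : ℕ) : digitSubst k n < 4 ^ k := by
  induction k with
  | zero => simp [digitSubst]
  | succ k ih =>
    rw [digitSubst, Finset.sum_range_succ, ← digitSubst, pow_succ]
    have : (3 * (n / 4 ^ k % 4) + 2) % 5 ≤ 3 := by
      have : n / 4 ^ k % 4 < 4 := Nat.mod_lt _ (by norm_num)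
      interval_cases n / 4 ^ k % 4 <;> norm_num
    nlinarith [Nat.mul_le_mul_left (4 ^ k) this]

theorem digitSubst_append (k l n : ℕ) {m : ℕ} (hm : m < 4 ^ l) :
    digitSubst (l + k) (4 ^ l * n + m) = 4 ^ l * digitSubst k n + digitSubst l m := by
  rw [digitSubst, Finset.sum_range_add, add_comm, digitSubst, digitSubst, Finset.mul_sum]
  congr 1
  · refine Finset.sum_congr rfl fun i _ => ?_
    rw [pow_add, mul_assoc, ← Nat.div_div_eq_div_mul,
      Nat.mul_add_div (by positivity), Nat.div_eq_of_lt hm, add_zero]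
  · refine Finset.sum_congr rfl fun i hi => ?_
    obtain ⟨j, rfl⟩ : ∃ j, l = i + 1 + j := ⟨l - (i + 1), by have := Finset.mem_range.1 hi; omega⟩
    rw [pow_add, pow_succ, show 4 ^ i * 4 * 4 ^ j * n + m = 4 ^ i * (4 * (4 ^ j * n)) + m by ring,
      Nat.mul_add_div (by positivity), Nat.mul_add_mod]

theorem lt_and_lt_of_lt_pow_add {k l n : ℕ} (h : n < 4 ^ (l + k)) :
    n / 4 ^ l < 4 ^ k ∧ n % 4 ^ l < 4 ^ l :=
  ⟨Nat.div_lt_of_lt_mul (by rwa [← pow_add]), Nat.mod_lt _ (by positivity)⟩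

theorem append_lt {k l n m : ℕ} (hn : n < 4 ^ k) (hm : m < 4 ^ l) :
    4 ^ l * n + m < 4 ^ (l + k) := by
  rw [pow_add]
  nlinarith [Nat.mul_le_mul_left (4 ^ l) (Nat.succ_le_of_lt hn)]

theorem digitSubst_div_mod (k l : ℕ) (n : ℕ) :
    digitSubst (l + k) n = 4 ^ l * digitSubst k (n / 4 ^ l) + digitSubst l (n % 4 ^ l) := by
  conv_lhs => rw [← Nat.div_add_mod n (4 ^ l)]
  exact digitSubst_append k l _ (Nat.mod_lt _ (by positivity))

theorem digitSubst_separated (k : ℕ) : ∀ {n m : ℕ}, n < 4 ^ k → m < 4 ^ k → n ≠ m →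
    2 ≤ |(n : ℤ) - m| ∨ 2 ≤ |(digitSubst k n : ℤ) - digitSubst k m| := by
  induction k with
  | zero => intro n m hn hm h; simp at hn hm; omega
  | succ k ih =>
    intro n m hn hm hne
    rw [add_comm] at hn hm ⊢
    have hn' := lt_and_lt_of_lt_pow_add hn
    have hm' := lt_and_lt_of_lt_pow_add hm
    rw [digitSubst_div_mod k 1 n, digitSubst_div_mod k 1 m]
    simp only [pow_one] at *
    have h1 : ∀ i, digitSubst 1 i = (3 * (i % 4) + 2) % 5 := by simp [digitSubst]
    rw [h1, h1, Nat.mod_mod, Nat.mod_mod]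
    by_cases h : n / 4 = m / 4
    · rw [h]
      simp only [le_abs]
      omega
    · have := ih hn'.1 hm'.1 h
      simp only [le_abs] at this ⊢
      push_cast
      omega

theorem digitSubst_separated_of_div_ne {k K n m : ℕ} (hn : n < 4 ^ k) (hm : m < 4 ^ k)
    (h : n / 4 ^ K ≠ m / 4 ^ K) :
    (4 : ℤ) ^ K ≤ |(n : ℤ) - m| ∨ (4 : ℤ) ^ K ≤ |(digitSubst k n : ℤ) - digitSubst k m| := by
  have hK : K ≤ k := by
    by_contra! hk
    have := Nat.pow_lt_pow_right (show 1 < 4 by norm_num) hk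
    exact h (by rw [Nat.div_eq_of_lt (by omega), Nat.div_eq_of_lt (by omega)])
  obtain ⟨l, rfl⟩ := Nat.exists_eq_add_of_le hK
  have h0 := digitSubst_separated l (lt_and_lt_of_lt_pow_add hn).1 (lt_and_lt_of_lt_pow_add hm).1 h
  have hn1 := Nat.div_add_mod n (4 ^ K)
  have hm1 := Nat.div_add_mod m (4 ^ K)
  have hn2 := (lt_and_lt_of_lt_pow_add hn).2
  have hm2 := (lt_and_lt_of_lt_pow_add hm).2
  have hn3 := digitSubst_lt K (n % 4 ^ K)
  have hm3 := digitSubst_lt K (m % 4 ^ K)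
  rw [digitSubst_div_mod l K n, digitSubst_div_mod l K m]
  zify at hn1 hm1 hn2 hm2 hn3 hm3
  simp only [le_abs] at h0 ⊢
  push_cast at h0 ⊢
  have hp : (0 : ℤ) < 4 ^ K := by positivity
  generalize (4 : ℤ) ^ K = P at *
  have : (0 : ℤ) ≤ (n : ℤ) % P := Int.emod_nonneg _ hp.ne'
  have : (0 : ℤ) ≤ (m : ℤ) % P := Int.emod_nonneg _ hp.ne'
  rcases h0 with (h0 | h0) | (h0 | h0)
  · exact Or.inl (Or.inl (by nlinarith [mul_le_mul_of_nonneg_left h0 hp.le]))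
  · exact Or.inl (Or.inr (by nlinarith [mul_le_mul_of_nonneg_left h0 hp.le]))
  · exact Or.inr (Or.inl (by nlinarith [mul_le_mul_of_nonneg_left h0 hp.le]))
  · exact Or.inr (Or.inr (by nlinarith [mul_le_mul_of_nonneg_left h0 hp.le]))

/-- The normalised height over `x` of the line coded by the word `n` of length `k`. -/
def height (x : ℝ) (k n : ℕ) : ℝ := n * x + digitSubst k n

theorem height_append (x : ℝ) (k l n : ℕ) {m : ℕ} (hm : m < 4 ^ l) :
    height x (l + k) (4 ^ l * n + m) = 4 ^ l * height x k n + height x l m := by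
  simp only [height, digitSubst_append k l n hm]
  push_cast
  ring

theorem height_div_mod (x : ℝ) (k l n : ℕ) :
    height x (l + k) n = 4 ^ l * height x k (n / 4 ^ l) + height x l (n % 4 ^ l) := by
  conv_lhs => rw [← Nat.div_add_mod n (4 ^ l)]
  exact height_append x k l _ (Nat.mod_lt _ (by positivity))

theorem abs_height_le (x : ℝ) {k n : ℕ} (hn : n < 4 ^ k) :
    |height x k n| ≤ (4 ^ k - 1) * (1 + |x|) := by
  have h1 : (n : ℝ) ≤ 4 ^ k - 1 := by
    have : n + 1 ≤ 4 ^ k := hn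
    rify at this; linarith
  have h2 : (digitSubst k n : ℝ) ≤ 4 ^ k - 1 := by
    have : digitSubst k n + 1 ≤ 4 ^ k := digitSubst_lt k n
    rify at this; linarith
  calc |height x k n| ≤ |n * x| + |(digitSubst k n : ℝ)| := abs_add_le _ _
    _ = n * |x| + digitSubst k n := by rw [abs_mul, Nat.abs_cast, Nat.abs_cast]
    _ ≤ (4 ^ k - 1) * |x| + (4 ^ k - 1) := by gcongr
    _ = _ := by ring

/-- At every scale, two words with different leading parts have heights at bounded distance. -/
theorem exists_height_sub_le (x : ℝ) (K : ℕ) : ∃ k n m, n < 4 ^ k ∧ m < 4 ^ k ∧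
    n / 4 ^ K ≠ m / 4 ^ K ∧ |height x k n - height x k m| ≤ 6 * (1 + |x|) := by
  by_contra! hsep
  set h : ℝ := 1 + |x| with hh
  have h1 : 1 ≤ h := by have := abs_nonneg x; linarith
  set M : ℕ := K + 2 with hM
  set V : Set ℝ := ⋃ b ∈ Finset.range (4 ^ K),
    Set.Icc (height x K b - 2 * h) (height x K b + 2 * h) with hV
  have memV : ∀ z, z ∈ V ↔ ∃ b < 4 ^ K, |z - height x K b| ≤ 2 * h := by
    intro z
    simp only [hV, Set.mem_iUnion, Finset.mem_range, exists_prop, Set.mem_Icc, abs_le]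
    exact exists_congr fun b => and_congr_right fun _ => by constructor <;> intro h <;>
      constructor <;> linarith [h.1, h.2]
  have hVm : MeasurableSet V := Finset.measurableSet_biUnion _ fun _ _ => measurableSet_Icc
  have hVfin : volume V ≠ ⊤ := by
    refine (lt_of_le_of_lt (measure_biUnion_finset_le _ _) ?_).ne
    exact ENNReal.sum_lt_top.2 fun b _ => by rw [Real.volume_Icc]; exact ENNReal.ofReal_lt_top
  set T : ℕ → Set ℝ := fun a => (fun z => z + -(4 ^ K * height x M a)) ⁻¹' V with hT
  have memT : ∀ a < 4 ^ M, ∀ z, z ∈ T a ↔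
      ∃ b < 4 ^ K, |z - height x (K + M) (4 ^ K * a + b)| ≤ 2 * h := by
    intro a ha z
    rw [hT, Set.mem_preimage, memV]
    refine exists_congr fun b => and_congr_right fun hb => ?_
    rw [height_append x M K a hb]
    ring_nf
  have hdiv : ∀ a b, b < 4 ^ K → (4 ^ K * a + b) / 4 ^ K = a := fun a b hb => by
    rw [Nat.mul_add_div (by positivity), Nat.div_eq_of_lt hb, add_zero]
  have hTm : ∀ a, MeasurableSet (T a) := fun a => hVm.preimage (by fun_prop)
  have hdisj : (↑(Finset.range (4 ^ M)) : Set ℕ).PairwiseDisjoint T := by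
    intro a ha a' ha' hne
    rw [Finset.coe_range, Set.mem_Iio] at ha ha'
    refine Set.disjoint_left.2 fun z hz hz' => ?_
    obtain ⟨b, hb, hz⟩ := (memT a ha z).1 hz
    obtain ⟨b', hb', hz'⟩ := (memT a' ha' z).1 hz'
    have := hsep (K + M) _ _ (append_lt ha hb) (append_lt ha' hb')
      (by rw [hdiv a b hb, hdiv a' b' hb']; exact hne)
    have h3 := abs_sub_le (height x (K + M) (4 ^ K * a + b)) z
      (height x (K + M) (4 ^ K * a' + b'))
    rw [abs_sub_comm _ z] at h3
    linarith
  set G : Set ℝ := ⋃ a ∈ Finset.range (4 ^ M), T a with hG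
  have hGvol : volume G = 4 ^ M * volume V := by
    rw [hG, measure_biUnion_finset hdisj fun a _ => hTm a]
    simp [hT, measure_preimage_add_right]
  set W : Set ℝ := (fun z => ((4 : ℝ) ^ M)⁻¹ * z) ⁻¹' V with hW
  have hWvol : volume W = 4 ^ M * volume V := by
    rw [hW, Real.volume_preimage_mul_left (by positivity), inv_inv, abs_of_pos (by positivity),
      ENNReal.ofReal_pow (by norm_num)]
    norm_num
  have memW : ∀ b < 4 ^ K, ∀ z, |z - 4 ^ M * height x K b| ≤ 4 ^ M * (2 * h) → z ∈ W := by
    intro b hb z hz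
    refine (memV _).2 ⟨b, hb, ?_⟩
    have hp : (0 : ℝ) < 4 ^ M := by positivity
    rw [show ((4 : ℝ) ^ M)⁻¹ * z - height x K b = (4 ^ M)⁻¹ * (z - 4 ^ M * height x K b) by
      field_simp, abs_mul, abs_of_pos (inv_pos.2 hp), inv_mul_le_iff₀ hp]
    exact hz
  have hMK : (4 : ℝ) ^ M = 16 * 4 ^ K := by rw [hM, pow_add]; ring
  have hK1 : (1 : ℝ) ≤ 4 ^ K := one_le_pow₀ (by norm_num)
  have hGW : G ⊆ W := by
    intro z hz
    simp only [hG, Set.mem_iUnion, Finset.mem_range, exists_prop] at hz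
    obtain ⟨a, ha, hz⟩ := hz
    obtain ⟨b, hb, hz⟩ := (memT a ha z).1 hz
    have hlt := append_lt ha hb
    rw [add_comm K M] at hlt hz
    obtain ⟨h2, h3⟩ := lt_and_lt_of_lt_pow_add hlt
    refine memW _ h2 z ?_
    rw [height_div_mod] at hz
    have h4 := abs_height_le x h3
    rw [← hh] at h4
    rw [abs_le] at *
    constructor <;> nlinarith
  obtain ⟨n₁, hn₁, hmax⟩ := Finset.exists_max_image (Finset.range (4 ^ K)) (height x (K + M))
    ⟨0, by simp⟩
  rw [Finset.mem_range] at hn₁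
  have hle : 4 ^ K ≤ 4 ^ (K + M) := Nat.pow_le_pow_right (by norm_num) (by omega)
  set Y := height x (K + M) n₁ with hY
  have hgap : Disjoint G (Set.Ioo (Y + 2 * h) (Y + 4 * h)) := by
    refine Set.disjoint_left.2 fun z hz hz' => ?_
    simp only [hG, Set.mem_iUnion, Finset.mem_range, exists_prop] at hz
    obtain ⟨a, ha, hz⟩ := hz
    obtain ⟨b, hb, hz⟩ := (memT a ha z).1 hz
    rw [abs_le] at hz
    rcases Nat.eq_zero_or_pos a with rfl | hpos
    · have := hmax b (Finset.mem_range.2 hb)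
      rw [mul_zero, zero_add] at hz
      linarith [hz'.1, hz.2]
    · have := hsep (K + M) _ n₁ (append_lt ha hb) (by omega)
        (by rw [hdiv a b hb, Nat.div_eq_of_lt hn₁]; omega)
      rw [lt_abs] at this
      rcases this with h | h <;> linarith [hz'.1, hz'.2, hz.1, hz.2]
  have hgapW : Set.Ioo (Y + 2 * h) (Y + 4 * h) ⊆ W := by
    intro z hz
    have hlt : n₁ < 4 ^ (M + K) := by rw [add_comm]; omega
    obtain ⟨h2, h3⟩ := lt_and_lt_of_lt_pow_add hlt
    have h4 := abs_height_le x h3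
    rw [← hh] at h4
    refine memW _ h2 z ?_
    have h6 : Y = 4 ^ M * height x K (n₁ / 4 ^ M) + height x M (n₁ % 4 ^ M) := by
      rw [hY, add_comm K M, height_div_mod]
    rw [h6] at hz
    rw [abs_le] at *
    constructor <;> nlinarith [hz.1, hz.2]
  have := measure_mono (μ := volume) (Set.union_subset hGW hgapW)
  rw [measure_union hgap measurableSet_Ioo, hGvol, hWvol, Real.volume_Ioo] at this
  have h7 : (0 : ENNReal) < ENNReal.ofReal (Y + 4 * h - (Y + 2 * h)) := by
    rw [ENNReal.ofReal_pos]; linarith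
  exact absurd this (not_le.2 (ENNReal.lt_add_right
    (ENNReal.mul_ne_top (by simp) hVfin) h7.ne'))

/-- The slopes over which two distinct words whose codes differ by `a` have the same height. -/
def coincidenceSlopes (a : ℕ) : Set ℝ :=
  {x | ∃ k n m, n < 4 ^ k ∧ m < 4 ^ k ∧ n ≠ m ∧ n = m + a ∧ height x k n = height x k m}

theorem frequently_mem_thickening_coincidenceSlopes (x : ℝ) {C : ℝ} (hC : 6 * (1 + |x|) < C) :
    ∃ᶠ a : ℕ in atTop, x ∈ Metric.thickening (C * (a : ℝ)⁻¹) (coincidenceSlopes a) := by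
  rw [frequently_atTop]
  intro N
  have hx := abs_nonneg x
  obtain ⟨K, hK⟩ := pow_unbounded_of_one_lt ((N + 7) * (1 + |x|)) (show (1 : ℝ) < 4 by norm_num)
  obtain ⟨k, n, m, hn, hm, hne, hle⟩ := exists_height_sub_le x K
  wlog hnm : m ≤ n generalizing n m
  · exact this m n hm hn hne.symm (by rwa [abs_sub_comm]) (by omega)
  obtain ⟨a, rfl⟩ := Nat.exists_eq_add_of_le hnm
  set B : ℝ := digitSubst k (m + a) - digitSubst k m with hB
  have heq : height x k (m + a) - height x k m = a * x + B := by
    simp only [height, hB]; push_cast; ring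
  rw [heq] at hle
  have hBle : |B| ≤ 6 * (1 + |x|) + a * |x| := by
    have := abs_sub (a * x + B) (a * x)
    rw [add_sub_cancel_left, abs_mul, Nat.abs_cast] at this
    linarith
  have hsep : (4 : ℝ) ^ K ≤ a ∨ (4 : ℝ) ^ K ≤ |B| := by
    have := digitSubst_separated_of_div_ne hn hm hne
    rify at this
    rw [← hB] at this
    simpa using this
  have haN : (N + 1 : ℝ) ≤ a := by
    by_contra! hlt
    rcases hsep with h | h
    · nlinarith
    · nlinarith
  have ha : (0 : ℝ) < a := by have : (0 : ℝ) ≤ N := N.cast_nonneg; linarith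
  have ha0 : 0 < a := by exact_mod_cast ha
  refine ⟨a, by have : (N : ℝ) ≤ a := by linarith
                exact_mod_cast this, Metric.mem_thickening_iff.2 ⟨-B / a, ?_, ?_⟩⟩
  · refine ⟨k, m + a, m, hn, hm, by omega, rfl, ?_⟩
    have : height (-B / a) k (m + a) - height (-B / a) k m = a * (-B / a) + B := by
      simp only [height, hB]; push_cast; ring
    rw [mul_div_cancel₀ _ ha.ne'] at this
    linarith
  · rw [Real.dist_eq, show x - -B / a = (a * x + B) * (a : ℝ)⁻¹ by field_simp; ring, abs_mul,
      abs_of_pos (inv_pos.2 ha)]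
    have := inv_pos.2 ha
    gcongr
    linarith

theorem ae_exists_height_sub_le : ∀ᵐ x : ℝ, ∀ δ > 0, ∃ k n m, n < 4 ^ k ∧ m < 4 ^ k ∧
    n ≠ m ∧ |height x k n - height x k m| ≤ δ := by
  have key : ∀ R j : ℕ, ∀ᵐ x : ℝ, |x| ≤ R → ∃ k n m, n < 4 ^ k ∧ m < 4 ^ k ∧
      n ≠ m ∧ |height x k n - height x k m| ≤ 1 / ((j : ℝ) + 1) := by
    intro R j
    have hr : Tendsto (fun a : ℕ => (a : ℝ)⁻¹) atTop (nhds 0) := tendsto_inv_atTop_nhds_zero_nat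
    have h1 := blimsup_thickening_mul_ae_eq (volume : Measure ℝ) (fun _ => True)
      coincidenceSlopes (M := 6 * (1 + R) + 1) (by positivity) _ hr
    have h2 := blimsup_thickening_mul_ae_eq (volume : Measure ℝ) (fun _ => True)
      coincidenceSlopes (M := 1 / ((j : ℝ) + 1)) (by positivity) _ hr
    filter_upwards [(h1.trans h2.symm).mem_iff] with x hx hxR
    rw [blimsup_true, blimsup_true, mem_limsup_iff_frequently_mem,
      mem_limsup_iff_frequently_mem] at hx
    obtain ⟨a, ha, ha0⟩ := ((hx.1 (frequently_mem_thickening_coincidenceSlopes x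
      (by linarith))).and_eventually (eventually_gt_atTop 0)).exists
    obtain ⟨z, ⟨k, n, m, hn, hm, hne, hnm, hz⟩, hd⟩ := Metric.mem_thickening_iff.1 ha
    refine ⟨k, n, m, hn, hm, hne, ?_⟩
    have ha' : (0 : ℝ) < a := by exact_mod_cast ha0
    have : height x k n - height x k m = a * (x - z) := by
      simp only [height, hnm] at hz ⊢
      push_cast at hz ⊢
      linarith
    rw [this, abs_mul, abs_of_pos ha', ← Real.dist_eq]
    rw [← div_eq_mul_inv, lt_div_iff₀ ha'] at hd
    linarith
  filter_upwards [ae_all_iff.2 fun R => ae_all_iff.2 (key R)] with x hx δ hδ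
  obtain ⟨R, hR⟩ := exists_nat_ge |x|
  obtain ⟨j, hj⟩ := exists_nat_one_div_lt hδ
  obtain ⟨k, n, m, hn, hm, hne, h⟩ := hx R j hR
  exact ⟨k, n, m, hn, hm, hne, h.trans hj.le⟩

/-- The heights over `x` that are compatible with some word of length `k`. -/
def approxFiber (x : ℝ) (k : ℕ) : Set ℝ :=
  {y | ∃ n < 4 ^ k, |4 ^ k * y - height x k n| ≤ 2 * (1 + |x|)}

/-- A closed planar null set containing the line set of the dust. -/
def limitSet : Set (ℝ × ℝ) := {p | ∀ k, p.2 ∈ approxFiber p.1 k}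

theorem abs_sub_height_div_le {x y e : ℝ} {k l n : ℕ}
    (h : |4 ^ (l + k) * y - height x (l + k) n| ≤ 4 ^ l * e) :
    |4 ^ k * y - height x k (n / 4 ^ l)| ≤ e + (1 + |x|) := by
  have h1 := abs_height_le x (Nat.mod_lt n (show 0 < 4 ^ l by positivity))
  have hp : (0 : ℝ) < 4 ^ l := by positivity
  rw [height_div_mod, pow_add, abs_le] at h
  rw [abs_le] at h1 ⊢
  have := abs_nonneg x
  constructor
  · refine le_of_mul_le_mul_left ?_ hp; nlinarith
  · refine le_of_mul_le_mul_left ?_ hp; nlinarith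

theorem approxFiber_antitone (x : ℝ) : Antitone (approxFiber x) := by
  refine antitone_nat_of_succ_le fun k y hy => ?_
  obtain ⟨n, hn, h⟩ := hy
  rw [add_comm k 1] at hn h
  refine ⟨n / 4 ^ 1, (lt_and_lt_of_lt_pow_add hn).1, ?_⟩
  have := abs_sub_height_div_le (e := (1 + |x|) / 2) (h.trans (by linarith))
  linarith [abs_nonneg x]

theorem isClosed_limitSet : IsClosed limitSet := by
  have : limitSet = ⋂ k, ⋃ n ∈ Finset.range (4 ^ k),
      {p : ℝ × ℝ | |4 ^ k * p.2 - height p.1 k n| ≤ 2 * (1 + |p.1|)} := by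
    ext p; simp [limitSet, approxFiber]
  rw [this]
  refine isClosed_iInter fun k => isClosed_biUnion_finset fun n _ => isClosed_le ?_ ?_
  · unfold height; fun_prop
  · fun_prop

theorem exists_scaled_mem_limitSet {x y : ℝ} (h : (x, y) ∈ limitSet) (k : ℕ) :
    ∃ n < 4 ^ k, (x, 4 ^ k * y - height x k n) ∈ limitSet := by
  by_contra! hcon
  simp only [limitSet, Set.mem_ofPred_eq, not_forall] at hcon
  choose! l hl using hcon
  set L := (Finset.range (4 ^ k)).sup l
  obtain ⟨n, hn, hy⟩ := h (L + k)
  obtain ⟨h1, h2⟩ := lt_and_lt_of_lt_pow_add hn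
  refine hl _ h1 (approxFiber_antitone x (Finset.le_sup (Finset.mem_range.2 h1)) ⟨_, h2, ?_⟩)
  rw [height_div_mod, pow_add] at hy
  convert hy using 2
  ring

theorem volume_affine_preimage (k : ℕ) (c : ℝ) (S : Set ℝ) :
    4 ^ k * volume {y : ℝ | 4 ^ k * y - c ∈ S} = volume S := by
  have : {y : ℝ | 4 ^ k * y - c ∈ S} = ((4 : ℝ) ^ k * ·) ⁻¹' ((· + -c) ⁻¹' S) := by
    ext y; simp [sub_eq_add_neg]
  rw [this, Real.volume_preimage_mul_left (by positivity), measure_preimage_add_right,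
    abs_of_pos (by positivity), ← mul_assoc, ENNReal.ofReal_inv_of_pos (by positivity),
    ENNReal.ofReal_pow (by norm_num)]
  norm_num
  rw [ENNReal.mul_inv_cancel (by simp) (by simp), one_mul]

theorem volume_limitSet_fiber_eq_zero {x : ℝ} (hx : ∀ δ > 0, ∃ k n m, n < 4 ^ k ∧ m < 4 ^ k ∧
    n ≠ m ∧ |height x k n - height x k m| ≤ δ) : volume (Prod.mk x ⁻¹' limitSet) = 0 := by
  set T : Set ℝ := Prod.mk x ⁻¹' limitSet with hT
  have hTc : IsCompact T := by
    refine Metric.isCompact_of_isClosed_isBounded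
      (isClosed_limitSet.preimage (by fun_prop)) ((Metric.isBounded_iff_subset_closedBall 0).2
        ⟨2 * (1 + |x|), fun y hy => ?_⟩)
    obtain ⟨n, hn, h⟩ := hy 0
    have hn : n = 0 := by simpa using hn
    simpa [height, hn, digitSubst] using h
  by_contra hne
  have hfin := hTc.measure_lt_top (μ := volume).ne
  have hlt : volume T < 2 * volume T := by
    rw [two_mul]; exact ENNReal.lt_add_right hfin hne
  obtain ⟨δ, hδ, hδT⟩ := (((tendsto_measure_cthickening_of_isCompact (μ := volume) hTc).eventually
    (gt_mem_nhds hlt)).filter_mono nhdsWithin_le_nhds |>.and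
      (self_mem_nhdsWithin (s := Set.Ioi (0 : ℝ)))).exists.imp fun _ h => And.symm h
  obtain ⟨k, n, m, hn, hm, hnm, hclose⟩ := hx δ hδ
  set D := ((Finset.range (4 ^ k)).erase n).erase m with hD
  have hcard : D.card + 2 = 4 ^ k := by
    have h1 : m ∈ (Finset.range (4 ^ k)).erase n := by simp [hnm.symm, hm]
    have h2 : n ∈ Finset.range (4 ^ k) := by simpa using hn
    have := Finset.card_erase_add_one h1
    have := Finset.card_erase_add_one h2
    rw [Finset.card_range] at this
    rw [hD]
    omega
  have hcover : T ⊆ {y | 4 ^ k * y - height x k n ∈ Metric.cthickening δ T} ∪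
      ⋃ i ∈ D, {y | 4 ^ k * y - height x k i ∈ T} := by
    intro y hy
    obtain ⟨i, hi, hiT⟩ := exists_scaled_mem_limitSet (x := x) (y := y) hy k
    by_cases hin : i = n ∨ i = m
    · refine Or.inl (Metric.mem_cthickening_of_dist_le _ _ _ _ hiT ?_)
      rw [Real.dist_eq, sub_sub_sub_cancel_left]
      rcases hin with rfl | rfl
      · simpa using hδ.le
      · rwa [abs_sub_comm]
    · rw [not_or] at hin
      exact Or.inr (Set.mem_biUnion (show i ∈ D by simp [hD, hin.1, hin.2, hi]) hiT)
  have hmeas := (measure_mono (μ := volume) hcover).trans ((measure_union_le _ _).trans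
    (add_le_add_right (measure_biUnion_finset_le _ _) _))
  have := mul_le_mul_right hmeas (4 ^ k)
  rw [mul_add, volume_affine_preimage, Finset.mul_sum] at this
  simp only [volume_affine_preimage, Finset.sum_const, nsmul_eq_mul] at this
  have h4 : (4 : ENNReal) ^ k = D.card + 2 := by exact_mod_cast hcard.symm
  rw [h4, add_mul, add_comm] at this
  exact absurd (ENNReal.le_of_add_le_add_right
    (ENNReal.mul_ne_top (ENNReal.natCast_ne_top _) hfin) this) (not_le.2 hδT)

theorem volume_limitSet : volume limitSet = 0 := by
  rw [Measure.volume_eq_prod, Measure.measure_prod_null isClosed_limitSet.measurableSet]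
  filter_upwards [ae_exists_height_sub_le] with x hx
  exact volume_limitSet_fiber_eq_zero hx

theorem exists_code_of_mem_Fword {w : List (Fin 4)} {q : ℝ × ℝ} (hq : q ∈ Fword w) :
    ∃ n : ℕ, n < 4 ^ w.length ∧ (n ≤ 4 ^ w.length * q.1 ∧ 4 ^ w.length * q.1 ≤ n + 1) ∧
      (digitSubst w.length n ≤ 4 ^ w.length * q.2 ∧
        4 ^ w.length * q.2 ≤ digitSubst w.length n + 1) := by
  induction w generalizing q with
  | nil =>
    obtain ⟨⟨h1, h2⟩, h3, h4⟩ := hq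
    exact ⟨0, by simp, by simp [h1, h2], by simp [digitSubst, h3, h4]⟩
  | cons i w ih =>
    obtain ⟨p, hp, rfl⟩ := hq
    obtain ⟨n, hn, h1, h2⟩ := ih hp
    have hi : (i : ℕ) < 4 ^ 1 := i.2
    refine ⟨4 ^ w.length * i + n, append_lt hi hn, ?_⟩
    rw [List.length_cons, digitSubst_append 1 _ _ hn, pow_succ]
    have h3 : (digitSubst 1 i : ℝ) = (![2, 0, 3, 1] : Fin 4 → ℝ) i := by
      fin_cases i <;> simp [digitSubst]
    push_cast
    rw [h3]
    simp only [Scontr]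
    refine ⟨⟨?_, ?_⟩, ?_, ?_⟩ <;> linarith [h1.1, h1.2, h2.1, h2.2]

theorem exists_height_close_of_mem_lineSet {p : ℝ × ℝ} (hp : p ∈ lineSet Fdust) (k : ℕ) :
    ∃ n : ℕ, n < 4 ^ k ∧ |4 ^ k * p.2 - height p.1 k n| ≤ 1 + |p.1| := by
  simp only [lineSet, Set.mem_iUnion, exists_prop] at hp
  obtain ⟨q, hq, hp⟩ := hp
  have hqk := Set.mem_iInter.1 hq k
  simp only [Fstage, Set.mem_iUnion, exists_prop] at hqk
  obtain ⟨w, hw, hqw⟩ := hqk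
  obtain ⟨n, hn, h1, h2⟩ := exists_code_of_mem_Fword hqw
  rw [show w.length = k from hw] at *
  refine ⟨n, hn, ?_⟩
  have hp : p.2 = q.1 * p.1 + q.2 := hp
  have : 4 ^ k * p.2 - height p.1 k n =
      (4 ^ k * q.1 - n) * p.1 + (4 ^ k * q.2 - digitSubst k n) := by
    rw [hp, height]; ring
  rw [this]
  refine (abs_add_le _ _).trans ?_
  rw [abs_mul, add_comm]
  have h3 : |4 ^ k * q.1 - n| ≤ 1 := abs_le.2 ⟨by linarith [h1.1], by linarith [h1.2]⟩
  have h4 : |4 ^ k * q.2 - digitSubst k n| ≤ 1 := abs_le.2 ⟨by linarith [h2.1], by linarith [h2.2]⟩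
  nlinarith [mul_le_mul_of_nonneg_right h3 (abs_nonneg p.1)]

/-- An arithmetical test whether the square of side `2⁻ᴿ` at grid position `(p - p', q - q')`
comes close to a line of the dust; `c` bounds the horizontal position. -/
def LineHit (c R p p' q q' : ℕ) : Prop :=
  ∃ n < 4 ^ R,
    4 ^ R * q + n * p' ≤
      4 ^ R * q' + n * p + digitSubst R n * 2 ^ R + (2 * 4 ^ R + 2 ^ R * c) ∧
    4 ^ R * q' + n * p + digitSubst R n * 2 ^ R ≤
      4 ^ R * q + n * p' + (2 * 4 ^ R + 2 ^ R * c)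

instance (c R p p' q q' : ℕ) : Decidable (LineHit c R p p' q q') := by
  unfold LineHit; infer_instance

/-- The point `x` is in the grid cell (or a neighbour) of index `p - p'` at resolution `2⁻ᴿ`. -/
def NearGrid (R : ℕ) (x : ℝ) (p p' : ℕ) : Prop := |2 ^ R * x - ((p : ℝ) - p')| ≤ 1

theorem NearGrid.neg {R : ℕ} {x : ℝ} {p p' : ℕ} (h : NearGrid R x p p') :
    NearGrid R (-x) p' p := by
  unfold NearGrid at *
  rw [← abs_neg]
  convert h using 2
  ring

theorem lineHit_iff (c R p p' q q' : ℕ) : LineHit c R p p' q q' ↔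
    ∃ n < 4 ^ R, |4 ^ R * ((q : ℝ) - q') - n * ((p : ℝ) - p') - digitSubst R n * 2 ^ R| ≤
      2 * 4 ^ R + 2 ^ R * c := by
  refine exists_congr fun n => and_congr_right fun _ => ?_
  rw [abs_le]
  rify
  constructor <;> intro h <;> constructor <;> linarith [h.1, h.2]

theorem abs_grid_error_le {R p p' q q' n : ℕ} {x y : ℝ} (hx : NearGrid R x p p')
    (hy : NearGrid R y q q') (hn : n < 4 ^ R) :
    |(4 ^ R * ((q : ℝ) - q') - n * ((p : ℝ) - p') - digitSubst R n * 2 ^ R) -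
      2 ^ R * (4 ^ R * y - height x R n)| ≤ 2 * 4 ^ R := by
  have : (4 ^ R * ((q : ℝ) - q') - n * ((p : ℝ) - p') - digitSubst R n * 2 ^ R) -
      2 ^ R * (4 ^ R * y - height x R n) =
      n * (2 ^ R * x - ((p : ℝ) - p')) - 4 ^ R * (2 ^ R * y - ((q : ℝ) - q')) := by
    rw [height]; ring
  rw [this]
  refine (abs_sub _ _).trans ?_
  rw [abs_mul, abs_mul, Nat.abs_cast, abs_of_pos (show (0 : ℝ) < 4 ^ R by positivity)]
  have hn' : (n : ℝ) ≤ 4 ^ R := by exact_mod_cast hn.le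
  have h1 := mul_le_mul hn' hx (abs_nonneg _) (by positivity)
  have h2 := mul_le_mul_of_nonneg_left hy (show (0 : ℝ) ≤ 4 ^ R by positivity)
  linarith

theorem lineHit_of_mem_lineSet {c R p p' q q' : ℕ} {x y : ℝ} (h : (x, y) ∈ lineSet Fdust)
    (hc : 1 + |x| ≤ c) (hx : NearGrid R x p p') (hy : NearGrid R y q q') :
    LineHit c R p p' q q' := by
  obtain ⟨n, hn, hle⟩ := exists_height_close_of_mem_lineSet h R
  refine (lineHit_iff ..).2 ⟨n, hn, ?_⟩
  have h1 := abs_grid_error_le hx hy hn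
  have h2 : |2 ^ R * (4 ^ R * y - height x R n)| ≤ 2 ^ R * c := by
    rw [abs_mul, abs_of_pos (by positivity)]
    exact mul_le_mul_of_nonneg_left (hle.trans hc) (by positivity)
  rw [abs_le] at *
  constructor <;> linarith

theorem eventually_not_lineHit (c : ℕ) {x y : ℝ} (h : (x, y) ∉ limitSet) :
    ∀ᶠ R in atTop, ∀ p p' q q', NearGrid R x p p' → NearGrid R y q q' →
      ¬ LineHit c R p p' q q' := by
  simp only [limitSet, Set.mem_ofPred_eq, not_forall] at h
  obtain ⟨k, hk⟩ := h
  filter_upwards [eventually_ge_atTop (4 * 2 ^ k + c + k)] with R hR p p' q q' hx hy hhit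
  refine hk ?_
  obtain ⟨l, rfl⟩ : ∃ l, R = l + k := ⟨R - k, by omega⟩
  obtain ⟨n, hn, hle⟩ := (lineHit_iff ..).1 hhit
  have h1 := abs_grid_error_le hx hy hn
  have hl : (4 * 2 ^ k + c : ℝ) ≤ 2 ^ l := by
    have : 4 * 2 ^ k + c ≤ 2 ^ l := (show 4 * 2 ^ k + c ≤ l by omega).trans Nat.lt_two_pow_self.le
    exact_mod_cast this
  have hl1 : (1 : ℝ) ≤ 2 ^ l := one_le_pow₀ (by norm_num)
  have h4 : ∀ i : ℕ, (4 : ℝ) ^ i = 2 ^ i * 2 ^ i := fun i => by rw [← mul_pow]; norm_num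
  have hp : (0 : ℝ) < 2 ^ (l + k) := by positivity
  have h2 : |4 ^ (l + k) * y - height x (l + k) n| ≤ 4 * 2 ^ (l + k) + c := by
    refine le_of_mul_le_mul_left ?_ hp
    rw [← abs_of_pos hp, ← abs_mul, abs_of_pos hp]
    have := h4 (l + k)
    rw [abs_le] at *
    constructor <;> nlinarith
  refine ⟨n / 4 ^ l, (lt_and_lt_of_lt_pow_add hn).1, ?_⟩
  have h5 := abs_sub_height_div_le (e := 1 + |x|) (h2.trans ?_)
  · linarith
  · have h6 : (4 : ℝ) * 2 ^ (l + k) + c ≤ 4 ^ l := by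
      have : (0 : ℝ) ≤ c := c.cast_nonneg
      rw [h4, pow_add]
      nlinarith
    nlinarith [abs_nonneg x, show (0 : ℝ) < 4 ^ l by positivity]

/-- A test whether the dyadic square `(u, v)` of side `2⁻ᴿ` comes close to one of the translates
of the Besicovitch set by vectors with coordinates in `[-j, j]`. -/
def Covered (j R u v : ℕ) : Prop :=
  ∃ s < 2 * j + 1, ∃ t < 2 * j + 1,
    LineHit (j + 2) R (u + j * 2 ^ R) (s * 2 ^ R) (v + j * 2 ^ R) (t * 2 ^ R) ∨
    LineHit (j + 2) R (v + j * 2 ^ R) (t * 2 ^ R) (s * 2 ^ R) (u + j * 2 ^ R) ∨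
    LineHit (j + 2) R (s * 2 ^ R) (u + j * 2 ^ R) (v + j * 2 ^ R) (t * 2 ^ R) ∨
    LineHit (j + 2) R (v + j * 2 ^ R) (t * 2 ^ R) (u + j * 2 ^ R) (s * 2 ^ R)

instance (j R u v : ℕ) : Decidable (Covered j R u v) := by
  unfold Covered; infer_instance

theorem nearGrid_translate {R u j s : ℕ} {x : ℝ} (h0 : (u : ℝ) ≤ x * 2 ^ R)
    (h1 : x * 2 ^ R < u + 1) : NearGrid R (x + j - s) (u + j * 2 ^ R) (s * 2 ^ R) := by
  rw [NearGrid, abs_le]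
  push_cast
  constructor <;> linarith

theorem mem_Bset {x y : ℝ} (h : (x, y) ∈ Bset) : (x, y) ∈ lineSet Fdust ∨
    (y, -x) ∈ lineSet Fdust ∨ (-x, y) ∈ lineSet Fdust ∨ (y, x) ∈ lineSet Fdust := by
  rcases h with (h | ⟨p, hp, h⟩) | ⟨p, hp | ⟨q, hq, rfl⟩, h⟩
  · exact Or.inl h
  · obtain ⟨rfl, rfl⟩ := Prod.mk.inj h
    exact Or.inr (Or.inl (by simpa using hp))
  · obtain ⟨rfl, rfl⟩ := Prod.mk.inj h
    exact Or.inr (Or.inr (Or.inl (by simpa using hp)))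
  · obtain ⟨rfl, rfl⟩ := Prod.mk.inj h
    exact Or.inr (Or.inr (Or.inr (by simpa [rotHalfPi] using hq)))

theorem covered_of_mem_Bset {j R u v : ℕ} {x y : ℝ} {s t : ℤ} (hB : (x - s, y - t) ∈ Bset)
    (hs : |s| ≤ j) (ht : |t| ≤ j) (hx : 0 ≤ x ∧ x < 1) (hy : 0 ≤ y ∧ y < 1)
    (hu0 : (u : ℝ) ≤ x * 2 ^ R) (hu1 : x * 2 ^ R < u + 1)
    (hv0 : (v : ℝ) ≤ y * 2 ^ R) (hv1 : y * 2 ^ R < v + 1) : Covered j R u v := by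
  rw [abs_le] at hs ht
  obtain ⟨s', hs'⟩ := Int.eq_ofNat_of_zero_le (show 0 ≤ s + j by omega)
  obtain ⟨t', ht'⟩ := Int.eq_ofNat_of_zero_le (show 0 ≤ t + j by omega)
  refine ⟨s', by omega, t', by omega, ?_⟩
  have gx := nearGrid_translate (j := j) (s := s') hu0 hu1
  have gy := nearGrid_translate (j := j) (s := t') hv0 hv1
  rify at hs ht hs' ht'
  rw [show x + j - s' = x - s by linarith] at gx
  rw [show y + j - t' = y - t by linarith] at gy
  have bx : 1 + |x - s| ≤ ((j + 2 : ℕ) : ℝ) := by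
    push_cast
    have : |x - s| ≤ j + 1 := abs_le.2 ⟨by linarith, by linarith⟩
    linarith
  have bY : 1 + |y - t| ≤ ((j + 2 : ℕ) : ℝ) := by
    push_cast
    have : |y - t| ≤ j + 1 := abs_le.2 ⟨by linarith, by linarith⟩
    linarith
  rcases mem_Bset hB with h | h | h | h
  · exact Or.inl (lineHit_of_mem_lineSet h bx gx gy)
  · exact Or.inr (Or.inl (lineHit_of_mem_lineSet h bY gy gx.neg))
  · exact Or.inr (Or.inr (Or.inl (lineHit_of_mem_lineSet h (by rwa [abs_neg]) gx.neg gy)))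
  · exact Or.inr (Or.inr (Or.inr (lineHit_of_mem_lineSet h bY gy gx)))

theorem MeasureTheory.MeasurePreserving.ae_notMem_limitSet {f : ℝ × ℝ → ℝ × ℝ}
    (hf : MeasurePreserving f) : ∀ᵐ z, f z ∉ limitSet :=
  hf.quasiMeasurePreserving.ae (measure_eq_zero_iff_ae_notMem.1 volume_limitSet)

theorem ae_notMem_limitSet_of_translate (a b : ℝ) : ∀ᵐ z : ℝ × ℝ,
    (z.1 + a, z.2 + b) ∉ limitSet ∧ (z.2 + b, -(z.1 + a)) ∉ limitSet ∧
    (-(z.1 + a), z.2 + b) ∉ limitSet ∧ (z.2 + b, z.1 + a) ∉ limitSet := by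
  have hT : MeasurePreserving (fun z : ℝ × ℝ => (z.1 + a, z.2 + b)) :=
    (measurePreserving_add_right volume a).prod (measurePreserving_add_right volume b)
  have hs : MeasurePreserving (Prod.swap : ℝ × ℝ → ℝ × ℝ) := Measure.measurePreserving_swap
  have hn := Measure.measurePreserving_neg (volume : Measure ℝ)
  have hi := MeasurePreserving.id (volume : Measure ℝ)
  have h1 := hT.ae_notMem_limitSet
  have h2 := ((hi.prod hn).comp (hs.comp hT)).ae_notMem_limitSet
  have h3 := ((hn.prod hi).comp hT).ae_notMem_limitSet
  have h4 := (hs.comp hT).ae_notMem_limitSet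
  filter_upwards [h1, h2, h3, h4] with z k1 k2 k3 k4 using ⟨k1, k2, k3, k4⟩

/-- The dyadic square of side `2⁻ᴿ` with index `p`. -/
def gridSquare (R : ℕ) (p : ℕ × ℕ) : Set (ℝ × ℝ) :=
  Set.Ico ((p.1 : ℝ) / 2 ^ R) ((p.1 + 1) / 2 ^ R) ×ˢ
    Set.Ico ((p.2 : ℝ) / 2 ^ R) ((p.2 + 1) / 2 ^ R)

theorem mem_gridSquare {R : ℕ} {p : ℕ × ℕ} {z : ℝ × ℝ} : z ∈ gridSquare R p ↔
    ((p.1 : ℝ) ≤ z.1 * 2 ^ R ∧ z.1 * 2 ^ R < p.1 + 1) ∧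
      ((p.2 : ℝ) ≤ z.2 * 2 ^ R ∧ z.2 * 2 ^ R < p.2 + 1) := by
  have : (0 : ℝ) < 2 ^ R := by positivity
  simp only [gridSquare, Set.mem_prod, Set.mem_Ico, div_le_iff₀ this, lt_div_iff₀ this]

theorem measurableSet_gridSquare (R : ℕ) (p : ℕ × ℕ) : MeasurableSet (gridSquare R p) :=
  measurableSet_Ico.prod measurableSet_Ico

theorem volume_gridSquare (R : ℕ) (p : ℕ × ℕ) :
    volume (gridSquare R p) = ENNReal.ofReal (1 / 4 ^ R) := by
  rw [gridSquare, Measure.volume_eq_prod, Measure.prod_prod, Real.volume_Ico, Real.volume_Ico,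
    ← ENNReal.ofReal_mul (by rw [← sub_div]; simp)]
  congr 1
  rw [show (4 : ℝ) = 2 * 2 by norm_num, mul_pow]
  field_simp
  ring

theorem disjoint_gridSquare {R : ℕ} {p q : ℕ × ℕ} (h : p ≠ q) :
    Disjoint (gridSquare R p) (gridSquare R q) := by
  refine Set.disjoint_left.2 fun z hp hq => h ?_
  rw [mem_gridSquare] at hp hq
  have key : ∀ {a b : ℕ} {w : ℝ}, (a : ℝ) ≤ w → w < a + 1 → (b : ℝ) ≤ w → w < b + 1 → a = b := by
    intro a b w h1 h2 h3 h4
    have h5 : (a : ℝ) < b + 1 := by linarith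
    have h6 : (b : ℝ) < a + 1 := by linarith
    norm_cast at h5 h6
    omega
  exact Prod.ext (key hp.1.1 hp.1.2 hq.1.1 hq.1.2) (key hp.2.1 hp.2.2 hq.2.1 hq.2.2)

/-- The number of dyadic squares of side `2⁻ᴿ` passing the test `Covered j`. -/
def coverCount (j R : ℕ) : ℕ :=
  ∑ u ∈ Finset.range (2 ^ R), ∑ v ∈ Finset.range (2 ^ R), if Covered j R u v then 1 else 0

/-- The indices of the dyadic squares of side `2⁻ᴿ` passing the test `Covered j`. -/
def coverIndices (j R : ℕ) : Finset (ℕ × ℕ) :=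
  (Finset.range (2 ^ R) ×ˢ Finset.range (2 ^ R)).filter fun p => Covered j R p.1 p.2

theorem card_coverIndices (j R : ℕ) : (coverIndices j R).card = coverCount j R := by
  rw [coverIndices, Finset.card_filter, Finset.sum_product, coverCount]

theorem volume_iUnion_coverIndices (j R : ℕ) :
    volume (⋃ p ∈ coverIndices j R, gridSquare R p) = ENNReal.ofReal (coverCount j R / 4 ^ R) := by
  rw [measure_biUnion_finset (fun p _ q _ h => disjoint_gridSquare h)
    fun p _ => measurableSet_gridSquare R p]
  simp only [volume_gridSquare, Finset.sum_const, card_coverIndices, nsmul_eq_mul]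
  rw [← ENNReal.ofReal_natCast, ← ENNReal.ofReal_mul (by positivity), mul_one_div]

theorem eventually_notMem_iUnion_coverIndices (j : ℕ) : ∀ᵐ z : ℝ × ℝ, ∀ᶠ R in atTop,
    z ∉ ⋃ p ∈ coverIndices j R, gridSquare R p := by
  have h : ∀ᵐ z : ℝ × ℝ, ∀ s t : ℕ,
      (z.1 + (j - s), z.2 + (j - t)) ∉ limitSet ∧ (z.2 + (j - t), -(z.1 + (j - s))) ∉ limitSet ∧
      (-(z.1 + (j - s)), z.2 + (j - t)) ∉ limitSet ∧
      (z.2 + (j - t), z.1 + (j - s)) ∉ limitSet :=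
    ae_all_iff.2 fun s => ae_all_iff.2 fun t => ae_notMem_limitSet_of_translate _ _
  filter_upwards [h] with z hz
  have h2 : ∀ᶠ R in atTop, ∀ s ∈ Finset.range (2 * j + 1), ∀ t ∈ Finset.range (2 * j + 1),
      (∀ p p' q q', NearGrid R (z.1 + (j - s)) p p' → NearGrid R (z.2 + (j - t)) q q' →
        ¬ LineHit (j + 2) R p p' q q') ∧
      (∀ p p' q q', NearGrid R (z.2 + (j - t)) p p' → NearGrid R (-(z.1 + (j - s))) q q' →
        ¬ LineHit (j + 2) R p p' q q') ∧
      (∀ p p' q q', NearGrid R (-(z.1 + (j - s))) p p' → NearGrid R (z.2 + (j - t)) q q' →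
        ¬ LineHit (j + 2) R p p' q q') ∧
      (∀ p p' q q', NearGrid R (z.2 + (j - t)) p p' → NearGrid R (z.1 + (j - s)) q q' →
        ¬ LineHit (j + 2) R p p' q q') := by
    refine (eventually_all_finset _).2 fun s _ => (eventually_all_finset _).2 fun t _ => ?_
    obtain ⟨h1, h2, h3, h4⟩ := hz s t
    exact (eventually_not_lineHit _ h1).and ((eventually_not_lineHit _ h2).and
      ((eventually_not_lineHit _ h3).and (eventually_not_lineHit _ h4)))
  filter_upwards [h2] with R hR
  simp only [Set.mem_iUnion, exists_prop, not_exists, not_and]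
  rintro ⟨u, v⟩ hp hmem
  obtain ⟨⟨hu0, hu1⟩, hv0, hv1⟩ := mem_gridSquare.1 hmem
  obtain ⟨s, hs, t, ht, hc⟩ := (Finset.mem_filter.1 hp).2
  obtain ⟨k1, k2, k3, k4⟩ := hR s (Finset.mem_range.2 hs) t (Finset.mem_range.2 ht)
  have gx := nearGrid_translate (j := j) (s := s) hu0 hu1
  have gy := nearGrid_translate (j := j) (s := t) hv0 hv1
  rw [add_sub_assoc] at gx gy
  rcases hc with hc | hc | hc | hc
  · exact k1 _ _ _ _ gx gy hc
  · exact k2 _ _ _ _ gy gx.neg hc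
  · exact k3 _ _ _ _ gx.neg gy hc
  · exact k4 _ _ _ _ gy gx hc

theorem exists_coverCount_le (j e : ℕ) : ∃ R, 2 ^ e * coverCount j R ≤ 4 ^ R := by
  have hB : (volume : Measure (ℝ × ℝ)) (Set.Icc 0 1 ×ˢ Set.Icc 0 1) ≠ ⊤ :=
    (isCompact_Icc.prod isCompact_Icc).measure_lt_top.ne
  have hlim := tendsto_measure_of_ae_tendsto_indicator (μ := (volume : Measure (ℝ × ℝ))) atTop
    (A := ∅) (As := fun R => ⋃ p ∈ coverIndices j R, gridSquare R p) MeasurableSet.empty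
    (fun R => Finset.measurableSet_biUnion _ fun p _ => measurableSet_gridSquare R p)
    (measurableSet_Icc.prod measurableSet_Icc) hB
    (Eventually.of_forall fun R => Set.iUnion₂_subset fun p hp z hz => ?_)
    (by simpa using eventually_notMem_iUnion_coverIndices j)
  · simp only [volume_iUnion_coverIndices, measure_empty] at hlim
    have hpos : (0 : ENNReal) < ENNReal.ofReal (1 / 2 ^ e) := by simp
    obtain ⟨R, hR⟩ := (hlim.eventually_lt_const hpos).exists
    have h2 := (ENNReal.ofReal_lt_ofReal_iff (by positivity)).1 hR
    rw [div_lt_div_iff₀ (by positivity) (by positivity)] at h2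
    refine ⟨R, ?_⟩
    rify
    linarith
  · obtain ⟨⟨hu0, hu1⟩, hv0, hv1⟩ := mem_gridSquare.1 hz
    have hp' := (Finset.mem_filter.1 hp).1
    rw [Finset.mem_product, Finset.mem_range, Finset.mem_range] at hp'
    have h1 : ((p.1 + 1 : ℕ) : ℝ) ≤ ((2 ^ R : ℕ) : ℝ) := Nat.cast_le.2 hp'.1
    have h2 : ((p.2 + 1 : ℕ) : ℝ) ≤ ((2 ^ R : ℕ) : ℝ) := Nat.cast_le.2 hp'.2
    push_cast at h1 h2
    have : (0 : ℝ) < 2 ^ R := by positivity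
    have a1 : (0 : ℝ) ≤ p.1 := by positivity
    have a2 : (0 : ℝ) ≤ p.2 := by positivity
    refine ⟨⟨?_, ?_⟩, ?_, ?_⟩ <;> refine le_of_mul_le_mul_right ?_ this <;> linarith

/-- The sum of `f` over the `R`-dyadic intervals meeting the `r`-dyadic interval of index `a`. -/
def intervalSum (R r a : ℕ) (f : ℕ → ℕ) : ℕ :=
  ∑ i ∈ Finset.range (2 ^ (R - r)), f ((a * 2 ^ (R - r) + i) / 2 ^ (r - R))

theorem intervalSum_of_lt {R r : ℕ} (h : r < R) (a : ℕ) (f : ℕ → ℕ) :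
    intervalSum R r a f =
      intervalSum R (r + 1) (2 * a) f + intervalSum R (r + 1) (2 * a + 1) f := by
  obtain ⟨k, rfl⟩ : ∃ k, R = r + 1 + k := ⟨R - (r + 1), by omega⟩
  simp only [intervalSum, show r + 1 + k - r = k + 1 by omega, show r - (r + 1 + k) = 0 by omega,
    show r + 1 + k - (r + 1) = k by omega, show r + 1 - (r + 1 + k) = 0 by omega, pow_zero,
    Nat.div_one]
  rw [show 2 ^ (k + 1) = 2 ^ k + 2 ^ k by ring, Finset.sum_range_add]
  congr 1 <;> refine Finset.sum_congr rfl fun i _ => ?_ <;> congr 1 <;> ring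

theorem intervalSum_of_le {R r : ℕ} (h : R ≤ r) (a : ℕ) (f : ℕ → ℕ) :
    intervalSum R r a f = f (a / 2 ^ (r - R)) := by
  simp [intervalSum, Nat.sub_eq_zero_of_le h]

theorem intervalSum_child {R r : ℕ} (h : R ≤ r) (a c : ℕ) (hc : c < 2) (f : ℕ → ℕ) :
    intervalSum R (r + 1) (2 * a + c) f = intervalSum R r a f := by
  rw [intervalSum_of_le h, intervalSum_of_le (h.trans r.le_succ), Nat.succ_sub h, pow_succ',
    ← Nat.div_div_eq_div_mul, show (2 * a + c) / 2 = a by omega]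

theorem intervalSum_add (R r a : ℕ) (f g : ℕ → ℕ) :
    intervalSum R r a (fun i => f i + g i) = intervalSum R r a f + intervalSum R r a g :=
  Finset.sum_add_distrib

/-- A scale at which the squares passing the test `Covered j` have total area at most `2⁻ʲ`. -/
def coverScale (j : ℕ) : ℕ := Nat.find (exists_coverCount_le j j)

/-- The number of squares of side `2⁻ᴿ` meeting the `r`-dyadic square `(a, b)` that pass the test
`Covered j`. -/
def localCount (j R r a b : ℕ) : ℕ :=
  intervalSum R r a fun u => intervalSum R r b fun v => if Covered j R u v then 1 else 0

/-- The proportion of the `r`-dyadic square `(a, b)` passing the test `Covered j`, normalised to be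
a martingale. -/
noncomputable def coverDensity (j r a b : ℕ) : ℝ :=
  localCount j (coverScale j) r a b / 4 ^ (coverScale j - r)

theorem coverDensity_nonneg (j r a b : ℕ) : 0 ≤ coverDensity j r a b := by
  unfold coverDensity; positivity

theorem coverDensity_eq_children (j r a b : ℕ) : 4 * coverDensity j r a b =
    coverDensity j (r + 1) (2 * a) (2 * b) + coverDensity j (r + 1) (2 * a) (2 * b + 1) +
    (coverDensity j (r + 1) (2 * a + 1) (2 * b) +
      coverDensity j (r + 1) (2 * a + 1) (2 * b + 1)) := by
  unfold coverDensity localCount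
  rcases lt_or_ge r (coverScale j) with h | h
  · obtain ⟨k, hk⟩ : ∃ k, coverScale j = r + 1 + k := ⟨coverScale j - (r + 1), by omega⟩
    rw [intervalSum_of_lt h]
    simp only [intervalSum_of_lt h b, intervalSum_add]
    simp only [hk, show r + 1 + k - r = k + 1 by omega, show r + 1 + k - (r + 1) = k by omega]
    push_cast
    field_simp
    ring
  · have h0 := fun a f => intervalSum_child h a 0 (by norm_num) f
    have h1 := fun a f => intervalSum_child h a 1 (by norm_num) f
    simp only [add_zero] at h0
    simp only [h0, h1, Nat.sub_eq_zero_of_le h, Nat.sub_eq_zero_of_le (h.trans r.le_succ)]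
    ring

theorem coverDensity_zero_le (j : ℕ) : coverDensity j 0 0 0 ≤ (1 / 2) ^ j := by
  have h := Nat.find_spec (exists_coverCount_le j j)
  have h1 : localCount j (coverScale j) 0 0 0 = coverCount j (coverScale j) := by
    simp [localCount, intervalSum, coverCount]
  rw [coverDensity, h1, Nat.sub_zero, one_div, inv_pow, ← one_div,
    div_le_div_iff₀ (by positivity) (by positivity)]
  change 2 ^ j * coverCount j (coverScale j) ≤ 4 ^ coverScale j at h
  rify at h
  linarith

theorem coverDensity_le (j : ℕ) : ∀ {r a b : ℕ}, a < 2 ^ r → b < 2 ^ r →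
    coverDensity j r a b ≤ 4 ^ r * (1 / 2) ^ j
  | 0, a, b, ha, hb => by
    obtain rfl : a = 0 := by simpa using ha
    obtain rfl : b = 0 := by simpa using hb
    simpa using coverDensity_zero_le j
  | r + 1, a, b, ha, hb => by
    have ih := coverDensity_le j (r := r) (a := a / 2) (b := b / 2) (by omega) (by omega)
    have hch := coverDensity_eq_children j r (a / 2) (b / 2)
    have n1 := coverDensity_nonneg j (r + 1) (2 * (a / 2)) (2 * (b / 2))
    have n2 := coverDensity_nonneg j (r + 1) (2 * (a / 2)) (2 * (b / 2) + 1)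
    have n3 := coverDensity_nonneg j (r + 1) (2 * (a / 2) + 1) (2 * (b / 2))
    have n4 := coverDensity_nonneg j (r + 1) (2 * (a / 2) + 1) (2 * (b / 2) + 1)
    rw [pow_succ]
    rcases Nat.div_add_mod a 2 ▸ Nat.mod_two_eq_zero_or_one a with h | h <;>
    rcases Nat.div_add_mod b 2 ▸ Nat.mod_two_eq_zero_or_one b with h' | h'
    all_goals
      have ea := Nat.div_add_mod a 2
      have eb := Nat.div_add_mod b 2
      grind

theorem summable_coverDensity {r a b : ℕ} (ha : a < 2 ^ r) (hb : b < 2 ^ r) :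
    Summable fun j => coverDensity j r a b :=
  Summable.of_nonneg_of_le (fun j => coverDensity_nonneg j r a b)
    (fun j => coverDensity_le j ha hb) (summable_geometric_two.mul_left _)

theorem tsum_coverDensity_eq_children {r a b : ℕ} (ha : a < 2 ^ r) (hb : b < 2 ^ r) :
    4 * ∑' j, coverDensity j r a b =
    ∑' j, coverDensity j (r + 1) (2 * a) (2 * b) + ∑' j, coverDensity j (r + 1) (2 * a) (2 * b + 1) +
    (∑' j, coverDensity j (r + 1) (2 * a + 1) (2 * b) +
      ∑' j, coverDensity j (r + 1) (2 * a + 1) (2 * b + 1)) := by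
  have h := pow_succ 2 r
  have s1 := summable_coverDensity (r := r + 1) (a := 2 * a) (b := 2 * b) (by omega) (by omega)
  have s2 := summable_coverDensity (r := r + 1) (a := 2 * a) (b := 2 * b + 1) (by omega) (by omega)
  have s3 := summable_coverDensity (r := r + 1) (a := 2 * a + 1) (b := 2 * b) (by omega) (by omega)
  have s4 :=
    summable_coverDensity (r := r + 1) (a := 2 * a + 1) (b := 2 * b + 1) (by omega) (by omega)
  rw [← s1.tsum_add s2, ← s3.tsum_add s4, ← (s1.add s2).tsum_add (s3.add s4), ← tsum_mul_left]
  simp only [coverDensity_eq_children]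

/-- The sum of the martingales `coverDensity j`. -/
noncomputable def coverMartingale : DyadicMartingale 2 where
  toFun r u := ∑' j, coverDensity j r (u 0).toNat (u 1).toNat
  nonneg r u := tsum_nonneg fun j => coverDensity_nonneg j r _ _
  fair r u hu := by
    obtain ⟨a, ha⟩ := Int.eq_ofNat_of_zero_le (hu 0).1
    obtain ⟨b, hb⟩ := Int.eq_ofNat_of_zero_le (hu 1).1
    have ha' : a < 2 ^ r := by have := (hu 0).2; rw [ha] at this; exact_mod_cast this
    have hb' : b < 2 ^ r := by have := (hu 1).2; rw [hb] at this; exact_mod_cast this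
    rw [← (finTwoArrowEquiv Bool).symm.sum_comp, Fintype.sum_prod_type]
    have e : ∀ c : ℕ, (2 * (c : ℤ) + 1).toNat = 2 * c + 1 ∧ (2 * (c : ℤ)).toNat = 2 * c := by
      intro c; omega
    have := tsum_coverDensity_eq_children ha' hb'
    norm_num [finTwoArrowEquiv, ha, hb, e]
    linarith

theorem coverDensity_eq_one {j r a b : ℕ} (h : coverScale j ≤ r)
    (hc : Covered j (coverScale j) (a / 2 ^ (r - coverScale j)) (b / 2 ^ (r - coverScale j))) :
    coverDensity j r a b = 1 := by
  simp [coverDensity, localCount, intervalSum_of_le h, hc, Nat.sub_eq_zero_of_le h]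

theorem dyadic_div_bounds {R r a : ℕ} {x : ℝ} (h : R ≤ r) (h0 : (a : ℝ) ≤ x * 2 ^ r)
    (h1 : x * 2 ^ r < a + 1) : ((a / 2 ^ (r - R) : ℕ) : ℝ) ≤ x * 2 ^ R ∧
      x * 2 ^ R < ((a / 2 ^ (r - R) : ℕ) : ℝ) + 1 := by
  obtain ⟨k, rfl⟩ := Nat.exists_eq_add_of_le h
  rw [Nat.add_sub_cancel_left]
  have hp : 0 < 2 ^ k := by positivity
  have hp' : (0 : ℝ) < 2 ^ k := by positivity
  have e1 : a / 2 ^ k * 2 ^ k ≤ a := Nat.div_mul_le_self a _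
  have e2 : a + 1 ≤ 2 ^ k * (a / 2 ^ k + 1) := Nat.lt_mul_div_succ a hp
  generalize a / 2 ^ k = q at *
  rify at e1 e2
  rw [pow_add] at h0 h1
  constructor
  · refine le_of_mul_le_mul_right ?_ hp'; linarith
  · refine lt_of_mul_lt_mul_right ?_ hp'.le; linarith

theorem succeedsAt_coverMartingale {x : Fin 2 → ℝ} (hx : x ∈ sharp BsetFin) :
    succeedsAt coverMartingale x := by
  obtain ⟨hx, hx'⟩ := hx
  obtain ⟨t, y, hy, hyx⟩ := Set.mem_iUnion.1 hx'
  have hB : (x 0 - t 0, x 1 - t 1) ∈ Bset := by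
    have h0 := congrFun hyx 0
    have h1 := congrFun hyx 1
    simp only [Pi.add_apply] at h0 h1
    rw [← h0, ← h1, add_sub_cancel_right, add_sub_cancel_right]
    exact hy
  refine (EReal.tendsto_coe_nhds_top_iff.2 (tendsto_atTop.2 fun M => ?_)).limsup_eq
  obtain ⟨K, hK⟩ := exists_nat_ge M
  set J := max (t 0).natAbs (t 1).natAbs
  have hev : ∀ᶠ r in atTop, ∀ j ∈ Finset.Ico J (J + K), coverScale j ≤ r :=
    (eventually_all_finset _).2 fun j _ => eventually_ge_atTop _
  filter_upwards [hev] with r hr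
  have hval : ∀ i, ∃ a : ℕ, a < 2 ^ r ∧ (⌊x i * 2 ^ r⌋).toNat = a ∧ (a : ℝ) ≤ x i * 2 ^ r ∧
      x i * 2 ^ r < a + 1 := by
    intro i
    have hp : (0 : ℝ) < 2 ^ r := by positivity
    have hpos : 0 ≤ x i * 2 ^ r := mul_nonneg (hx i).1 hp.le
    refine ⟨⌊x i * 2 ^ r⌋₊, ?_, rfl, Nat.floor_le hpos, Nat.lt_floor_add_one _⟩
    rw [Nat.floor_lt hpos]
    push_cast
    nlinarith [(hx i).2]
  obtain ⟨a, ha, hfa, ha0, ha1⟩ := hval 0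
  obtain ⟨b, hb, hfb, hb0, hb1⟩ := hval 1
  change M ≤ ∑' j, coverDensity j r (⌊x 0 * 2 ^ r⌋).toNat (⌊x 1 * 2 ^ r⌋).toNat
  rw [hfa, hfb]
  refine hK.trans (le_trans (le_of_eq ?_) ((summable_coverDensity ha hb).sum_le_tsum
    (Finset.Ico J (J + K)) fun j _ => coverDensity_nonneg j r a b))
  rw [Finset.sum_congr rfl fun j hj => coverDensity_eq_one (hr j hj) ?_]
  · simp
  · have h0 := dyadic_div_bounds (hr j hj) ha0 ha1
    have h1 := dyadic_div_bounds (hr j hj) hb0 hb1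
    have hj' := (Finset.mem_Ico.1 hj).1
    have ht := fun i => Int.abs_eq_natAbs (t i)
    exact covered_of_mem_Bset hB (by rw [ht]; omega) (by rw [ht]; omega) (hx 0) (hx 1) h0.1 h0.2 h1.1 h1.2

section Computability

variable {α : Type*} [Primcodable α]

theorem Primrec.sum_range {f : α → ℕ} {g : α → ℕ → ℕ} (hf : Primrec f) (hg : Primrec₂ g) :
    Primrec fun a => ∑ i ∈ Finset.range (f a), g a i := by
  have hstep : Primrec₂ fun (a : α) (p : ℕ × ℕ) => p.2 + g a p.1 :=
    Primrec.nat_add.comp (Primrec.snd.comp Primrec.snd)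
      (hg.comp Primrec.fst (Primrec.fst.comp Primrec.snd))
  refine (Primrec.nat_rec' hf (Primrec.const 0) hstep).of_eq fun a => ?_
  induction f a with
  | zero => rfl
  | succ n ih => rw [Finset.sum_range_succ, ← ih]

theorem Computable.sum_range {f : α → ℕ} {g : α → ℕ → ℕ} (hf : Computable f)
    (hg : Computable₂ g) : Computable fun a => ∑ i ∈ Finset.range (f a), g a i := by
  have hstep : Computable₂ fun (a : α) (p : ℕ × ℕ) => p.2 + g a p.1 :=
    Primrec.nat_add.to_comp.comp (Computable.snd.comp Computable.snd)
      (hg.comp Computable.fst (Computable.fst.comp Computable.snd))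
  refine (Computable.nat_rec hf (Computable.const 0) hstep).of_eq fun a => ?_
  induction f a with
  | zero => rfl
  | succ n ih => rw [Finset.sum_range_succ, ← ih]

theorem Primrec.nat_pow_const (b : ℕ) : Primrec fun n : ℕ => b ^ n := by
  have hstep : Primrec₂ fun (_ n : ℕ) => n * b := Primrec.nat_mul.comp Primrec.snd (Primrec.const b)
  refine (Primrec.nat_rec₁ 1 hstep).of_eq fun n => ?_
  induction n with
  | zero => rfl
  | succ n ih => rw [pow_succ, ← ih]

theorem PrimrecPred.exists_lt_param {f : α → ℕ} {P : α → ℕ → Prop} (hf : Primrec f)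
    (hP : PrimrecRel P) : PrimrecPred fun a => ∃ n < f a, P a n :=
  ((hP.swap.exists_mem_list).comp (Primrec.list_range.comp hf) Primrec.id).of_eq fun a => by
    simp [Function.swap]

theorem PrimrecPred.nat_dvd {f g : α → ℕ} (hf : Primrec f) (hg : Primrec g) :
    PrimrecPred fun a => f a ∣ g a :=
  (Primrec.eq.comp (Primrec.nat_mod.comp hg hf) (Primrec.const 0)).of_eq fun _ =>
    Nat.dvd_iff_mod_eq_zero.symm

theorem Primrec.nat_gcd : Primrec₂ Nat.gcd := by
  have hd : PrimrecRel fun (p : ℕ × ℕ) (n : ℕ) => n ∣ p.1 ∧ n ∣ p.2 :=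
    (PrimrecPred.nat_dvd Primrec.snd (Primrec.fst.comp Primrec.fst)).and
      (PrimrecPred.nat_dvd Primrec.snd (Primrec.snd.comp Primrec.fst))
  refine (Primrec.nat_findGreatest (Primrec.nat_add.comp Primrec.fst Primrec.snd) hd).of_eq
    fun ⟨a, b⟩ => ?_
  change Nat.findGreatest (fun n => n ∣ a ∧ n ∣ b) (a + b) = a.gcd b
  rcases Nat.eq_zero_or_pos (a + b) with h | h
  · obtain ⟨rfl, rfl⟩ : a = 0 ∧ b = 0 := by omega
    rfl
  · refine le_antisymm ?_ (Nat.le_findGreatest ?_ ⟨Nat.gcd_dvd_left a b, Nat.gcd_dvd_right a b⟩)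
    · have hs := Nat.findGreatest_spec (P := fun n => n ∣ a ∧ n ∣ b) (m := 1) (n := a + b) h
        ⟨one_dvd _, one_dvd _⟩
      refine Nat.le_of_dvd (Nat.pos_of_ne_zero fun h0 => ?_) (Nat.dvd_gcd hs.1 hs.2)
      rw [Nat.gcd_eq_zero_iff] at h0
      omega
    · rcases Nat.eq_zero_or_pos a with rfl | ha
      · simp
      · exact (Nat.gcd_le_left b ha).trans (Nat.le_add_right a b)

theorem Primrec.int_toNat : Primrec Int.toNat := by
  refine (Primrec.ite (Primrec.eq.comp (Primrec.nat_mod.comp Primrec.encode (Primrec.const 2))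
    (Primrec.const 0)) (Primrec.nat_div.comp Primrec.encode (Primrec.const 2))
    (Primrec.const 0)).of_eq fun z => ?_
  cases z with
  | ofNat n =>
    have : Encodable.encode (n : ℤ) = 2 * n := rfl
    simp [this]
  | negSucc n =>
    have : Encodable.encode (Int.negSucc n) = 2 * n + 1 := rfl
    simp [this, Nat.add_mod]

/-- The codes of rationals among the codes of pairs of an integer and a natural number. -/
def IsRatCode (m : ℕ) : Prop := 0 < m.unpair.2 ∧ ((m.unpair.1 + 1) / 2).gcd m.unpair.2 = 1

instance : DecidablePred IsRatCode := fun m => by unfold IsRatCode; infer_instance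

theorem primrecPred_isRatCode : PrimrecPred IsRatCode := by
  have h1 := Primrec.fst.comp Primrec.unpair
  have h2 := Primrec.snd.comp Primrec.unpair
  exact (Primrec.nat_lt.comp (Primrec.const 0) h2).and (Primrec.eq.comp (Primrec.nat_gcd.comp
    (Primrec.nat_div.comp (Primrec.succ.comp h1) (Primrec.const 2)) h2) (Primrec.const 1))

theorem natAbs_intEquivNat_symm (k : ℕ) : (Equiv.intEquivNat.symm k).natAbs = (k + 1) / 2 := by
  obtain ⟨z, rfl⟩ := Equiv.intEquivNat.surjective k
  rw [Equiv.symm_apply_apply]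
  cases z with
  | ofNat n =>
    have : Equiv.intEquivNat (Int.ofNat n) = 2 * n := rfl
    rw [this, Int.natAbs_ofNat']
    omega
  | negSucc n =>
    have : Equiv.intEquivNat (Int.negSucc n) = 2 * n + 1 := rfl
    rw [this, Int.natAbs_negSucc]
    omega

theorem mem_range_encode_rat (m : ℕ) :
    m ∈ Set.range (@Encodable.encode ℚ Rat.instEncodable) ↔ IsRatCode m := by
  have henc : ∀ q : ℚ, @Encodable.encode ℚ Rat.instEncodable q =
      Nat.pair (Equiv.intEquivNat q.num) q.den := fun _ => rfl
  rw [IsRatCode, ← natAbs_intEquivNat_symm]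
  constructor
  · rintro ⟨q, rfl⟩
    rw [henc, Nat.unpair_pair, Equiv.symm_apply_apply]
    exact ⟨q.pos, q.reduced⟩
  · rintro ⟨h1, h2⟩
    refine ⟨⟨Equiv.intEquivNat.symm m.unpair.1, m.unpair.2, h1.ne', h2⟩, ?_⟩
    rw [henc, Equiv.apply_symm_apply, Nat.pair_unpair]

theorem encode_rat (q : ℚ) : @Encodable.encode ℚ Primcodable.toEncodable q =
    ∑ m ∈ Finset.range (Nat.pair (Encodable.encode q.num) q.den),
      if IsRatCode m then 1 else 0 := by
  have h : @Encodable.encode ℚ Primcodable.toEncodable q =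
      (List.range (@Encodable.encode ℚ Rat.instEncodable q)).countP
      fun m => @decide (m ∈ Set.range (@Encodable.encode ℚ Rat.instEncodable))
        (@Encodable.decidableRangeEncode ℚ Rat.instEncodable m) := rfl
  rw [h, ← Finset.card_filter, List.countP_eq_length_filter]
  simp only [mem_range_encode_rat]
  rfl

theorem Primrec.natCast_div_two_pow : Primrec₂ fun k m : ℕ => (k : ℚ) / 2 ^ m := by
  have hden : Primrec fun p : ℕ × ℕ => 2 ^ p.2 := (Primrec.nat_pow_const 2).comp Primrec.snd
  have hgcd : Primrec fun p : ℕ × ℕ => p.1.gcd (2 ^ p.2) := Primrec.nat_gcd.comp Primrec.fst hden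
  have hcode : Primrec fun p : ℕ × ℕ =>
      Nat.pair (2 * (p.1 / p.1.gcd (2 ^ p.2))) (2 ^ p.2 / p.1.gcd (2 ^ p.2)) :=
    Primrec₂.natPair.comp
      (Primrec.nat_mul.comp (Primrec.const 2) (Primrec.nat_div.comp Primrec.fst hgcd))
      (Primrec.nat_div.comp hden hgcd)
  have hind : Primrec₂ fun (_ : ℕ × ℕ) (m : ℕ) => if IsRatCode m then 1 else 0 :=
    (Primrec.ite primrecPred_isRatCode (Primrec.const 1) (Primrec.const 0)).comp Primrec.snd
  refine Primrec.encode_iff.1 ((Primrec.sum_range hcode hind).of_eq fun ⟨k, m⟩ => ?_)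
  have hg : 0 < k.gcd (2 ^ m) := Nat.gcd_pos_of_pos_right _ (by positivity)
  have hcop := Nat.coprime_div_gcd_div_gcd hg
  have hpos : 0 < 2 ^ m / k.gcd (2 ^ m) :=
    Nat.div_pos (Nat.gcd_le_right _ (by positivity)) hg
  have hq : (k : ℚ) / 2 ^ m =
      (((k / k.gcd (2 ^ m) : ℕ) : ℤ) : ℚ) / (((2 ^ m / k.gcd (2 ^ m) : ℕ) : ℤ) : ℚ) := by
    rw [Int.cast_natCast, Int.cast_natCast, Nat.cast_div_charZero (Nat.gcd_dvd_left _ _),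
      Nat.cast_div_charZero (Nat.gcd_dvd_right _ _), div_div_div_cancel_right₀ (by positivity)]
    norm_num
  have hnum := Rat.num_div_eq_of_coprime (a := ((k / k.gcd (2 ^ m) : ℕ) : ℤ))
    (b := ((2 ^ m / k.gcd (2 ^ m) : ℕ) : ℤ)) (by exact_mod_cast hpos) hcop
  have hden := Rat.den_div_eq_of_coprime (a := ((k / k.gcd (2 ^ m) : ℕ) : ℤ))
    (b := ((2 ^ m / k.gcd (2 ^ m) : ℕ) : ℤ)) (by exact_mod_cast hpos) hcop
  change _ = @Encodable.encode ℚ Primcodable.toEncodable ((k : ℚ) / 2 ^ m)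
  rw [encode_rat, hq, hnum, Nat.cast_inj.1 hden]
  rfl

end Computability

section Computability

variable {α : Type*} [Primcodable α]

theorem primrec_digitSubst {f g : α → ℕ} (hf : Primrec f) (hg : Primrec g) :
    Primrec fun a => digitSubst (f a) (g a) := by
  have hpow : Primrec fun p : α × ℕ => 4 ^ p.2 := (Primrec.nat_pow_const 4).comp Primrec.snd
  have hdig : Primrec fun p : α × ℕ => g p.1 / 4 ^ p.2 % 4 :=
    Primrec.nat_mod.comp (Primrec.nat_div.comp (hg.comp Primrec.fst) hpow) (Primrec.const 4)
  exact Primrec.sum_range hf (Primrec.nat_mul.comp hpow (Primrec.nat_mod.comp (Primrec.nat_add.comp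
    (Primrec.nat_mul.comp (Primrec.const 3) hdig) (Primrec.const 2)) (Primrec.const 5)))

theorem primrecPred_lineHit {c R p p' q q' : α → ℕ} (hc : Primrec c) (hR : Primrec R)
    (hp : Primrec p) (hp' : Primrec p') (hq : Primrec q) (hq' : Primrec q') :
    PrimrecPred fun a => LineHit (c a) (R a) (p a) (p' a) (q a) (q' a) := by
  have h4 : Primrec fun a => 4 ^ R a := (Primrec.nat_pow_const 4).comp hR
  have h2 : Primrec fun a => 2 ^ R a := (Primrec.nat_pow_const 2).comp hR
  have hd : Primrec fun x : α × ℕ => digitSubst (R x.1) x.2 * 2 ^ R x.1 :=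
    Primrec.nat_mul.comp (primrec_digitSubst (hR.comp Primrec.fst) Primrec.snd)
      (h2.comp Primrec.fst)
  have he : Primrec fun x : α × ℕ => 2 * 4 ^ R x.1 + 2 ^ R x.1 * c x.1 :=
    (Primrec.nat_add.comp (Primrec.nat_mul.comp (Primrec.const 2) h4)
      (Primrec.nat_mul.comp h2 hc)).comp Primrec.fst
  have hside : ∀ {s t : α → ℕ}, Primrec s → Primrec t →
      Primrec fun x : α × ℕ => 4 ^ R x.1 * s x.1 + x.2 * t x.1 := fun hs ht =>
    Primrec.nat_add.comp ((Primrec.nat_mul.comp h4 hs).comp Primrec.fst)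
      (Primrec.nat_mul.comp Primrec.snd (ht.comp Primrec.fst))
  have hl := hside hq hp'
  have hr := Primrec.nat_add.comp (hside hq' hp) hd
  exact PrimrecPred.exists_lt_param h4 ((Primrec.nat_le.comp hl (Primrec.nat_add.comp hr he)).and
    (Primrec.nat_le.comp hr (Primrec.nat_add.comp hl he)))

theorem primrecPred_covered {j R u v : α → ℕ} (hj : Primrec j) (hR : Primrec R)
    (hu : Primrec u) (hv : Primrec v) :
    PrimrecPred fun a => Covered (j a) (R a) (u a) (v a) := by
  have hlen : Primrec fun a => 2 * j a + 1 :=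
    Primrec.succ.comp (Primrec.nat_mul.comp (Primrec.const 2) hj)
  have hpow : Primrec fun a => 2 ^ R a := (Primrec.nat_pow_const 2).comp hR
  have hfst : Primrec fun x : (α × ℕ) × ℕ => x.1.1 := Primrec.fst.comp Primrec.fst
  have hs : Primrec fun x : (α × ℕ) × ℕ => x.1.2 * 2 ^ R x.1.1 :=
    Primrec.nat_mul.comp (Primrec.snd.comp Primrec.fst) (hpow.comp hfst)
  have ht : Primrec fun x : (α × ℕ) × ℕ => x.2 * 2 ^ R x.1.1 :=
    Primrec.nat_mul.comp Primrec.snd (hpow.comp hfst)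
  have hshift : ∀ {w : α → ℕ}, Primrec w →
      Primrec fun x : (α × ℕ) × ℕ => w x.1.1 + j x.1.1 * 2 ^ R x.1.1 := fun hw =>
    (Primrec.nat_add.comp hw (Primrec.nat_mul.comp hj hpow)).comp hfst
  have hX := hshift hu
  have hY := hshift hv
  have hc : Primrec fun x : (α × ℕ) × ℕ => j x.1.1 + 2 :=
    (Primrec.nat_add.comp hj (Primrec.const 2)).comp hfst
  have hR' := hR.comp hfst
  refine PrimrecPred.exists_lt_param hlen
    (PrimrecPred.exists_lt_param (α := α × ℕ) (hlen.comp Primrec.fst) ?_)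
  exact (primrecPred_lineHit hc hR' hX hs hY ht).or ((primrecPred_lineHit hc hR' hY ht hs hX).or
    ((primrecPred_lineHit hc hR' hs hX hY ht).or (primrecPred_lineHit hc hR' hY ht hX hs)))

theorem primrec_intervalSum {R r a : α → ℕ} {f : α → ℕ → ℕ} (hR : Primrec R) (hr : Primrec r)
    (ha : Primrec a) (hf : Primrec₂ f) : Primrec fun x => intervalSum (R x) (r x) (a x) (f x) := by
  have h1 : Primrec fun x => 2 ^ (R x - r x) :=
    (Primrec.nat_pow_const 2).comp (Primrec.nat_sub.comp hR hr)
  have h2 : Primrec fun x => 2 ^ (r x - R x) :=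
    (Primrec.nat_pow_const 2).comp (Primrec.nat_sub.comp hr hR)
  exact Primrec.sum_range h1 (hf.comp Primrec.fst (Primrec.nat_div.comp (Primrec.nat_add.comp
    ((Primrec.nat_mul.comp ha h1).comp Primrec.fst) Primrec.snd) (h2.comp Primrec.fst)))

theorem primrec_localCount : Primrec fun x : ℕ × ℕ × ℕ × ℕ × ℕ =>
    localCount x.1 x.2.1 x.2.2.1 x.2.2.2.1 x.2.2.2.2 := by
  have hj : Primrec fun x : ℕ × ℕ × ℕ × ℕ × ℕ => x.1 := Primrec.fst
  have hR : Primrec fun x : ℕ × ℕ × ℕ × ℕ × ℕ => x.2.1 := Primrec.fst.comp Primrec.snd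
  have hr : Primrec fun x : ℕ × ℕ × ℕ × ℕ × ℕ => x.2.2.1 :=
    Primrec.fst.comp (Primrec.snd.comp Primrec.snd)
  have ha : Primrec fun x : ℕ × ℕ × ℕ × ℕ × ℕ => x.2.2.2.1 :=
    Primrec.fst.comp (Primrec.snd.comp (Primrec.snd.comp Primrec.snd))
  have hb : Primrec fun x : ℕ × ℕ × ℕ × ℕ × ℕ => x.2.2.2.2 :=
    Primrec.snd.comp (Primrec.snd.comp (Primrec.snd.comp Primrec.snd))
  have hfst := Primrec.fst (α := ℕ × ℕ × ℕ × ℕ × ℕ) (β := ℕ)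
  have hfst2 := hfst.comp (Primrec.fst (α := (ℕ × ℕ × ℕ × ℕ × ℕ) × ℕ) (β := ℕ))
  refine primrec_intervalSum hR hr ha (primrec_intervalSum (α := (ℕ × ℕ × ℕ × ℕ × ℕ) × ℕ)
    (hR.comp hfst) (hr.comp hfst) (hb.comp hfst) ?_)
  exact Primrec.ite (primrecPred_covered (hj.comp hfst2) (hR.comp hfst2)
    (Primrec.snd.comp Primrec.fst) Primrec.snd) (Primrec.const 1) (Primrec.const 0)

theorem primrec_coverCount : Primrec₂ coverCount := by
  have hpow : Primrec fun x : ℕ × ℕ => 2 ^ x.2 := (Primrec.nat_pow_const 2).comp Primrec.snd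
  have hfst2 : Primrec fun x : ((ℕ × ℕ) × ℕ) × ℕ => x.1.1 := Primrec.fst.comp Primrec.fst
  refine Primrec.sum_range hpow (Primrec.sum_range (α := (ℕ × ℕ) × ℕ) (hpow.comp Primrec.fst) ?_)
  exact Primrec.ite (primrecPred_covered (Primrec.fst.comp hfst2) (Primrec.snd.comp hfst2)
    (Primrec.snd.comp Primrec.fst) Primrec.snd) (Primrec.const 1) (Primrec.const 0)

theorem computable_coverScale : Computable coverScale := by
  have hp : PrimrecRel fun j R : ℕ => 2 ^ j * coverCount j R ≤ 4 ^ R :=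
    Primrec.nat_le.comp (Primrec.nat_mul.comp ((Primrec.nat_pow_const 2).comp Primrec.fst)
      primrec_coverCount) ((Primrec.nat_pow_const 4).comp Primrec.snd)
  refine Partrec.of_eq_tot (Partrec.rfind hp.decide.to_comp.partrec₂) fun j => ?_
  rw [Nat.mem_rfind]
  refine ⟨?_, fun {m} hm => ?_⟩
  · have := Nat.find_spec (exists_coverCount_le j j)
    simpa [coverScale] using this
  · have := Nat.find_min (exists_coverCount_le j j) hm
    simpa using this

end Computability

/-- The common exponent of the denominators of the first `J` densities on `r`-dyadic squares. -/
def densityExponent (J r : ℕ) : ℕ := ∑ j ∈ Finset.range J, (coverScale j - r)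

/-- The numerator over `4 ^ densityExponent J r` of the sum of the first `J` densities. -/
def densityNumerator (J r a b : ℕ) : ℕ :=
  ∑ j ∈ Finset.range J,
    localCount j (coverScale j) r a b * 4 ^ (densityExponent J r - (coverScale j - r))

theorem densityNumerator_div (J r a b : ℕ) :
    (densityNumerator J r a b : ℝ) / 2 ^ (2 * densityExponent J r) =
      ∑ j ∈ Finset.range J, coverDensity j r a b := by
  rw [densityNumerator, pow_mul, Nat.cast_sum, Finset.sum_div]
  refine Finset.sum_congr rfl fun j hj => ?_
  have hle : coverScale j - r ≤ densityExponent J r :=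
    Finset.single_le_sum (f := fun j => coverScale j - r) (fun _ _ => Nat.zero_le _) hj
  obtain ⟨k, hk⟩ := Nat.exists_eq_add_of_le hle
  rw [hk, Nat.add_sub_cancel_left, coverDensity, pow_add]
  push_cast
  norm_num
  field_simp

theorem abs_sum_coverDensity_sub_tsum_le {s r a b : ℕ} (ha : a < 2 ^ r) (hb : b < 2 ^ r) :
    |∑ j ∈ Finset.range (s + 2 * r + 1), coverDensity j r a b - ∑' j, coverDensity j r a b| ≤
      2 ^ (-(s : ℤ)) := by
  have hs := summable_coverDensity ha hb
  rw [← hs.sum_add_tsum_nat_add (s + 2 * r + 1), sub_add_cancel_left, abs_neg,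
    abs_of_nonneg (tsum_nonneg fun j => coverDensity_nonneg _ r a b)]
  have hle : ∀ i, coverDensity (i + (s + 2 * r + 1)) r a b ≤ 2 ^ (-(s : ℤ)) / 2 * (1 / 2) ^ i := by
    intro i
    refine (coverDensity_le _ ha hb).trans (le_of_eq ?_)
    rw [zpow_neg, zpow_natCast, show (4 : ℝ) = 2 ^ 2 by norm_num, ← pow_mul]
    simp only [pow_add, one_div, inv_pow]
    field_simp
  have hg := summable_geometric_two.mul_left ((2 : ℝ) ^ (-(s : ℤ)) / 2)
  refine (((summable_nat_add_iff _).2 hs).tsum_le_tsum hle hg).trans (le_of_eq ?_)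
  rw [tsum_mul_left, tsum_geometric_two]
  ring

theorem computable_densityExponent : Computable₂ densityExponent :=
  Computable.sum_range Computable.fst (Primrec.nat_sub.to_comp.comp
    (computable_coverScale.comp Computable.snd) (Computable.snd.comp Computable.fst))

section

variable {α : Type*} [Primcodable α]

theorem computable_localCount {j R r a b : α → ℕ}
    (hj : Computable j) (hR : Computable R)
    (hr : Computable r) (ha : Computable a) (hb : Computable b) :
    Computable fun x => localCount (j x) (R x) (r x) (a x) (b x) := by
  have h := primrec_localCount.to_comp.comp (hj.pair (hR.pair (hr.pair (ha.pair hb))))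
  exact h
theorem computable_densityNumerator {J r a b : α → ℕ}
    (hJ : Computable J) (hr : Computable r) (ha : Computable a) (hb : Computable b) :
    Computable fun x => densityNumerator (J x) (r x) (a x) (b x) := by
  have hfst := Computable.fst (α := α) (β := ℕ)
  have hr' : Computable fun x : α × ℕ => r x.1 := hr.comp hfst
  have hc : Computable fun x : α × ℕ => coverScale x.2 :=
    computable_coverScale.comp Computable.snd
  have he : Computable fun x : α × ℕ => densityExponent (J x.1) (r x.1) :=
    computable_densityExponent.comp (hJ.comp hfst) hr'
  have hl := computable_localCount Computable.snd hc hr' (ha.comp hfst) (hb.comp hfst)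
  have hsub : Computable fun x : α × ℕ => densityExponent (J x.1) (r x.1) - (coverScale x.2 - r x.1) :=
    Primrec.nat_sub.to_comp.comp he (Primrec.nat_sub.to_comp.comp hc hr')
  have hpow : Computable fun x : α × ℕ => 4 ^ (densityExponent (J x.1) (r x.1) - (coverScale x.2 - r x.1)) :=
    (Primrec.nat_pow_const 4).to_comp.comp hsub
  have hm : Computable fun x : α × ℕ =>
      localCount x.2 (coverScale x.2) (r x.1) (a x.1) (b x.1) *
        4 ^ (densityExponent (J x.1) (r x.1) - (coverScale x.2 - r x.1)) :=
    Primrec.nat_mul.to_comp.comp hl hpow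
  exact Computable.sum_range hJ hm

theorem computable_densitySum {J r a b : α → ℕ}
    (hJ : Computable J) (hr : Computable r) (ha : Computable a) (hb : Computable b) :
    Computable fun x =>
      (densityNumerator (J x) (r x) (a x) (b x) : ℚ) / 2 ^ (2 * densityExponent (J x) (r x)) := by
  have hn := computable_densityNumerator hJ hr ha hb
  have he := computable_densityExponent.comp hJ hr
  have hm := Primrec.nat_mul.to_comp.comp (Computable.const 2) he
  have h := Primrec.natCast_div_two_pow.to_comp.comp hn hm
  exact h

end

theorem isComputable_coverMartingale : coverMartingale.IsComputable := by
  refine ⟨fun p => (densityNumerator (p.1 + 2 * p.2.1 + 1) p.2.1 (p.2.2 0).toNat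
    (p.2.2 1).toNat : ℚ) / 2 ^ (2 * densityExponent (p.1 + 2 * p.2.1 + 1) p.2.1), ?_,
    fun p => by positivity, fun s r u hu => ?_⟩
  · have hr : Computable fun p : ℕ × ℕ × (Fin 2 → ℤ) => p.2.1 :=
      Computable.fst.comp Computable.snd
    have hJ : Computable fun p : ℕ × ℕ × (Fin 2 → ℤ) => p.1 + 2 * p.2.1 + 1 :=
      (Primrec.succ.comp (Primrec.nat_add.comp Primrec.fst (Primrec.nat_mul.comp (Primrec.const 2)
        (Primrec.fst.comp Primrec.snd)))).to_comp
    have hu : ∀ i : Fin 2, Computable fun p : ℕ × ℕ × (Fin 2 → ℤ) => (p.2.2 i).toNat := fun i =>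
      (Primrec.int_toNat.comp (Primrec.fin_app.comp (Primrec.snd.comp Primrec.snd)
        (Primrec.const i))).to_comp
    exact computable_densitySum hJ hr (hu 0) (hu 1)
  · have hlt : ∀ i, (u i).toNat < 2 ^ r := fun i => by
      have := hu i
      zify
      rw [Int.toNat_of_nonneg this.1]
      exact this.2
    push_cast
    rw [densityNumerator_div]
    exact abs_sum_coverDensity_sub_tsum_le (hlt 0) (hlt 1)

/-- `B` has computable measure 0: some computable martingale on
`[0,1)²` succeeds at every point of `B^#`. -/
theorem Bset_hasComputableMeasureZero : HasComputableMeasureZero BsetFin :=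
  ⟨coverMartingale, isComputable_coverMartingale, fun _ => succeedsAt_coverMartingale⟩
end
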